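/- arXiv:0901.0536 — 2 statements merged into one kernel-verified Lean document; each statement's English description precedes it below -/
import Mathlib

section
/- The sequence (E_ℓ)_{ℓ ≥ 2} converges to 1 as ℓ → ∞, i.e., lim_{ℓ→∞} E_ℓ = 1. -/
/-- The partial distance `D_i` of the `i`-th row of `G` (0-indexed): the Hamming
distance from row `i` to the GF(2)-linear span of the rows below it. For the last
row the span is `{0}`, so `D_ℓ` is the Hamming weight of the last row. -/
noncomputable def partialDist {ℓ : ℕ} (G : Matrix (Fin ℓ) (Fin ℓ) (ZMod 2)) (i : Fin ℓ) : ℕ :=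
  sInf {d : ℕ | ∃ c ∈ Submodule.span (ZMod 2) {v : Fin ℓ → ZMod 2 | ∃ j, i < j ∧ v = G j},
    d = hammingDist (G i) c}

/-- The exponent `E(G) = (1/ℓ) ∑_i log_ℓ D_i`. -/
noncomputable def expE {ℓ : ℕ} (G : Matrix (Fin ℓ) (Fin ℓ) (ZMod 2)) : ℝ :=
  (1 / ℓ : ℝ) * ∑ i, Real.logb ℓ (partialDist G i)

/-- `E_ℓ`: the maximum of `E(G)` over invertible `ℓ×ℓ` matrices over GF(2). -/
noncomputable def Emax (ℓ : ℕ) : ℝ :=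
  sSup {x : ℝ | ∃ G : Matrix (Fin ℓ) (Fin ℓ) (ZMod 2), IsUnit G ∧ x = expE G}

open Finset in
/-- A Hamming ball of radius `d` in `GF(2)^n` has at most `(n+1)^d` points. -/
theorem card_hammingNorm_le (n d : ℕ) :
    #{v : Fin n → ZMod 2 | hammingNorm v ≤ d} ≤ (n + 1) ^ d := by
  induction d with
  | zero => simp [Finset.filter_eq']
  | succ d ih =>
    have hsub : ({v : Fin n → ZMod 2 | hammingNorm v ≤ d + 1} : Finset _) ⊆
        ((univ : Finset (Option (Fin n))) ×ˢ
          ({v : Fin n → ZMod 2 | hammingNorm v ≤ d} : Finset _)).image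
          (fun p => p.2 + p.1.elim 0 (fun i => Pi.single i 1)) := by
      intro v hv
      simp only [mem_filter_univ] at hv
      simp only [mem_image, mem_product, mem_univ, mem_filter_univ, true_and, Prod.exists]
      by_cases h0 : v = 0
      · exact ⟨none, 0, by simp, by simp [h0]⟩
      · obtain ⟨i, hi⟩ := Function.ne_iff.mp h0
        refine ⟨some i, Function.update v i 0, ?_, ?_⟩
        · have herase : ({j | Function.update v i 0 j ≠ 0} : Finset (Fin n)) =
              ({j | v j ≠ 0} : Finset (Fin n)).erase i := by
            ext j
            by_cases hj : j = i <;> simp [hj]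
          unfold hammingNorm at hv ⊢
          rw [herase, card_erase_of_mem (by simpa using hi)]
          omega
        · have h1 : v i = 1 := by
            have : ∀ a : ZMod 2, a ≠ 0 → a = 1 := by decide
            exact this _ hi
          ext j
          by_cases hj : j = i
          · subst hj; simp [h1]
          · simp [hj]
    calc _ ≤ _ := card_le_card hsub
      _ ≤ _ := card_image_le
      _ = (n + 1) * #{v : Fin n → ZMod 2 | hammingNorm v ≤ d} := by simp
      _ ≤ (n + 1) * (n + 1) ^ d := by gcongr
      _ = _ := by ring

open Finset in
/-- Sphere covering: a code which is small enough has covering radius greater than `d`. -/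
theorem exists_forall_lt_hammingDist {n d : ℕ} (C : Submodule (ZMod 2) (Fin n → ZMod 2))
    (h : 2 ^ Module.finrank (ZMod 2) C * (n + 1) ^ d < 2 ^ n) :
    ∃ g, ∀ c ∈ C, d < hammingDist g c := by
  classical
  by_contra! hc
  have hsub : (univ : Finset (Fin n → ZMod 2)) ⊆
      ((univ : Finset C) ×ˢ ({v : Fin n → ZMod 2 | hammingNorm v ≤ d} : Finset _)).image
        (fun p => p.1 + p.2) := by
    intro g _
    obtain ⟨c, hcC, hd⟩ := hc g
    simp only [mem_image, mem_product, mem_univ, mem_filter_univ, true_and, Prod.exists]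
    refine ⟨⟨c, hcC⟩, g - c, ?_, by simp⟩
    rwa [sub_eq_neg_add, ← hammingDist_eq_hammingNorm, hammingDist_comm]
  refine absurd h (not_lt.mpr ?_)
  calc 2 ^ n = #(univ : Finset (Fin n → ZMod 2)) := by simp [ZMod.card]
    _ ≤ _ := card_le_card hsub
    _ ≤ _ := card_image_le
    _ = Fintype.card C * #{v : Fin n → ZMod 2 | hammingNorm v ≤ d} := by simp
    _ = 2 ^ Module.finrank (ZMod 2) C * #{v : Fin n → ZMod 2 | hammingNorm v ≤ d} := by
      rw [Module.card_eq_pow_finrank (K := ZMod 2), ZMod.card]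
    _ ≤ _ := by gcongr; exact card_hammingNorm_le n d

/-- Gilbert–Varshamov: vectors chosen greedily keep their distance from the span of the previous
ones. -/
theorem exists_greedy_sequence (n d : ℕ) :
    ∃ g : ℕ → Fin n → ZMod 2,
      (∀ j < n, Module.finrank (ZMod 2)
          (Submodule.span (ZMod 2) {v | ∃ i < j + 1, v = g i}) = j + 1 ∧
        g j ∉ Submodule.span (ZMod 2) {v | ∃ i < j, v = g i}) ∧
      ∀ j < n, 2 ^ j * (n + 1) ^ d < 2 ^ n →
        ∀ c ∈ Submodule.span (ZMod 2) {v | ∃ i < j, v = g i}, d < hammingDist (g j) c := by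
  have hpick : ∀ C : Submodule (ZMod 2) (Fin n → ZMod 2), ∃ g, (C ≠ ⊤ → g ∉ C) ∧
      (2 ^ Module.finrank (ZMod 2) C * (n + 1) ^ d < 2 ^ n → ∀ c ∈ C, d < hammingDist g c) := by
    intro C
    by_cases h : 2 ^ Module.finrank (ZMod 2) C * (n + 1) ^ d < 2 ^ n
    · obtain ⟨g, hg⟩ := exists_forall_lt_hammingDist C h
      exact ⟨g, fun _ hgC => by simpa using hg g hgC, fun _ => hg⟩
    · by_cases hC : C = ⊤
      · exact ⟨0, fun h' => absurd hC h', fun h' => absurd h' h⟩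
      · obtain ⟨g, -, hg⟩ := SetLike.exists_of_lt (lt_top_iff_ne_top.mpr hC)
        exact ⟨g, fun _ => hg, fun h' => absurd h' h⟩
  choose pick hnot hfar using hpick
  obtain ⟨C, hzero, hsucc⟩ : ∃ C : ℕ → Submodule (ZMod 2) (Fin n → ZMod 2), C 0 = ⊥ ∧
      ∀ j, C (j + 1) = C j ⊔ Submodule.span (ZMod 2) {pick (C j)} :=
    ⟨fun j => Nat.rec ⊥ (fun _ D => D ⊔ Submodule.span (ZMod 2) {pick D}) j, rfl, fun _ => rfl⟩
  have hspan : ∀ j, Submodule.span (ZMod 2) {v | ∃ i < j, v = pick (C i)} = C j := by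
    intro j
    induction j with
    | zero => simp [hzero]
    | succ j ih =>
      rw [hsucc, ← ih, ← Submodule.span_union]
      congr 1
      ext v
      simp only [Set.mem_ofPred_eq, Set.mem_union, Set.mem_singleton_iff, ih,
        Nat.lt_succ_iff_lt_or_eq]
      constructor
      · rintro ⟨i, hi | rfl, hv⟩
        exacts [Or.inl ⟨i, hi, hv⟩, Or.inr hv]
      · rintro (⟨i, hi, hv⟩ | hv)
        exacts [⟨i, Or.inl hi, hv⟩, ⟨j, Or.inr rfl, hv⟩]
  have hne : ∀ j : ℕ, j < n → Module.finrank (ZMod 2) (C j) = j → C j ≠ ⊤ := by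
    intro j hj hr htop
    rw [htop, finrank_top] at hr
    simp at hr
    omega
  have hrank : ∀ j : ℕ, j ≤ n → Module.finrank (ZMod 2) (C j) = j := by
    intro j
    induction j with
    | zero => intro _; simp [hzero]
    | succ j ih =>
      intro hj
      have hr := ih (by omega)
      have hnj := hnot _ (hne j hj hr)
      have hlt : C j < C (j + 1) := by
        refine SetLike.lt_iff_le_and_exists.mpr ⟨?_, pick (C j), ?_, hnj⟩
        · rw [hsucc]; exact le_sup_left
        · rw [hsucc]
          exact Submodule.mem_sup_right (Submodule.mem_span_singleton_self _)
      have h1 := Submodule.finrank_lt_finrank_of_lt hlt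
      have h2 := Submodule.finrank_add_le_finrank_add_finrank (C j)
        (Submodule.span (ZMod 2) {pick (C j)})
      have h3 := finrank_span_le_card (R := ZMod 2) ({pick (C j)} : Set (Fin n → ZMod 2))
      rw [Set.toFinset_singleton, Finset.card_singleton] at h3
      rw [← hsucc] at h2
      omega
  refine ⟨fun j => pick (C j), fun j hj => ?_, fun j hj h => ?_⟩
  · rw [hspan, hspan]
    exact ⟨hrank _ hj, hnot _ (hne j hj (hrank j hj.le))⟩
  · rw [hspan]
    refine hfar _ ?_
    rwa [hrank j hj.le]

theorem le_partialDist {ℓ m : ℕ} {G : Matrix (Fin ℓ) (Fin ℓ) (ZMod 2)} {i : Fin ℓ}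
    (h : ∀ c ∈ Submodule.span (ZMod 2) {v : Fin ℓ → ZMod 2 | ∃ j, i < j ∧ v = G j},
      m ≤ hammingDist (G i) c) : m ≤ partialDist G i := by
  refine le_csInf ⟨_, 0, Submodule.zero_mem _, rfl⟩ ?_
  rintro _ ⟨c, hc, rfl⟩
  exact h c hc

theorem partialDist_le {ℓ : ℕ} (G : Matrix (Fin ℓ) (Fin ℓ) (ZMod 2)) (i : Fin ℓ) :
    partialDist G i ≤ ℓ := by
  calc partialDist G i ≤ hammingDist (G i) 0 :=
        Nat.sInf_le ⟨0, Submodule.zero_mem _, rfl⟩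
    _ ≤ Fintype.card (Fin ℓ) := hammingDist_le_card_fintype
    _ = ℓ := Fintype.card_fin ℓ

theorem expE_le_one {ℓ : ℕ} (hℓ : 2 ≤ ℓ) (G : Matrix (Fin ℓ) (Fin ℓ) (ZMod 2)) :
    expE G ≤ 1 := by
  have h1 : (1 : ℝ) < ℓ := by exact_mod_cast hℓ
  have hterm : ∀ i, Real.logb ℓ (partialDist G i) ≤ 1 := by
    intro i
    rcases Nat.eq_zero_or_pos (partialDist G i) with h | h
    · simp [h]
    · rw [← Real.logb_self_eq_one h1]
      exact Real.logb_le_logb_of_le h1 (by exact_mod_cast h)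
        (by exact_mod_cast partialDist_le G i)
  calc expE G ≤ (1 / ℓ : ℝ) * ∑ _i : Fin ℓ, (1 : ℝ) := by
        unfold expE
        gcongr
        exact hterm _
    _ = 1 := by simp; field_simp

/-- A matrix with many large partial distances. -/
theorem exists_isUnit_partialDist (ℓ d : ℕ) :
    ∃ G : Matrix (Fin ℓ) (Fin ℓ) (ZMod 2), IsUnit G ∧ ∀ i, 1 ≤ partialDist G i ∧
      (2 ^ (i.rev : ℕ) * (ℓ + 1) ^ d < 2 ^ ℓ → d + 1 ≤ partialDist G i) := by
  obtain ⟨g, hg, hfar⟩ := exists_greedy_sequence ℓ d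
  let G : Matrix (Fin ℓ) (Fin ℓ) (ZMod 2) := fun i => g i.rev
  have hset : ∀ i : Fin ℓ, {v : Fin ℓ → ZMod 2 | ∃ j, i < j ∧ v = G j} =
      {v | ∃ j < (i.rev : ℕ), v = g j} := by
    intro i
    ext v
    constructor
    · rintro ⟨j, hj, rfl⟩
      exact ⟨j.rev, Fin.rev_lt_rev.mpr hj, rfl⟩
    · rintro ⟨j, hj, rfl⟩
      have hjl : j < ℓ := hj.trans i.rev.isLt
      refine ⟨(⟨j, hjl⟩ : Fin ℓ).rev, ?_, by simp only [G, Fin.rev_rev]⟩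
      rw [← Fin.rev_lt_rev, Fin.rev_rev]
      exact hj
  refine ⟨G, ?_, fun i => ⟨?_, fun h => ?_⟩⟩
  · rw [← Matrix.linearIndependent_rows_iff_isUnit]
    refine linearIndependent_of_top_le_span_of_card_eq_finrank ?_ (by simp)
    rcases Nat.eq_zero_or_pos ℓ with rfl | hpos
    · intro v _
      rw [Subsingleton.elim v 0]
      exact Submodule.zero_mem _
    · have hr := (hg (ℓ - 1) (by omega)).1
      rw [Nat.sub_add_cancel hpos] at hr
      have htop := Submodule.eq_top_of_finrank_eq (hr.trans (by simp :
        ℓ = Module.finrank (ZMod 2) (Fin ℓ → ZMod 2)))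
      rw [← htop, Submodule.span_le]
      rintro v ⟨j, hj, rfl⟩
      exact Submodule.subset_span ⟨(⟨j, hj⟩ : Fin ℓ).rev, by simp only [G, Matrix.row, Fin.rev_rev]⟩
  · refine le_partialDist fun c hc => ?_
    rw [hset] at hc
    refine hammingDist_pos.mpr ?_
    rintro rfl
    exact (hg _ i.rev.isLt).2 hc
  · refine le_partialDist fun c hc => ?_
    rw [hset] at hc
    exact hfar _ i.rev.isLt h c hc

theorem le_Emax {ℓ s d : ℕ} (hℓ : 2 ≤ ℓ) (hs : ℓ + 1 ≤ 2 ^ s) :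
    (1 - (s * d : ℝ) / ℓ) * Real.logb ℓ (d + 1) ≤ Emax ℓ := by
  obtain ⟨G, hG, hD⟩ := exists_isUnit_partialDist ℓ d
  have h1 : (1 : ℝ) < ℓ := by exact_mod_cast hℓ
  have hlog : 0 ≤ Real.logb ℓ (d + 1) :=
    Real.logb_nonneg h1 (le_add_of_nonneg_left (Nat.cast_nonneg d))
  have hle : expE G ≤ Emax ℓ :=
    le_csSup ⟨1, by rintro _ ⟨G, -, rfl⟩; exact expE_le_one hℓ G⟩ ⟨G, hG, rfl⟩
  refine le_trans ?_ hle
  have hterm : ∀ i : Fin ℓ, (if (i.rev : ℕ) < ℓ - s * d then Real.logb ℓ (d + 1) else 0) ≤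
      Real.logb ℓ (partialDist G i) := by
    intro i
    split_ifs with hi
    · refine Real.logb_le_logb_of_le h1 (by positivity) ?_
      have : 2 ^ (i.rev : ℕ) * (ℓ + 1) ^ d < 2 ^ ℓ := by
        calc 2 ^ (i.rev : ℕ) * (ℓ + 1) ^ d ≤ 2 ^ (i.rev : ℕ) * (2 ^ s) ^ d := by gcongr
          _ = 2 ^ ((i.rev : ℕ) + s * d) := by rw [← pow_mul, ← pow_add]
          _ < 2 ^ ℓ := Nat.pow_lt_pow_right (by norm_num) (by omega)
      exact_mod_cast (hD i).2 this
    · exact Real.logb_nonneg h1 (by exact_mod_cast (hD i).1)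
  have hsum : ∑ i : Fin ℓ, (if (i.rev : ℕ) < ℓ - s * d then Real.logb ℓ (d + 1) else 0) =
      ((ℓ - s * d : ℕ) : ℝ) * Real.logb ℓ (d + 1) := by
    refine (Equiv.sum_comp Fin.revPerm
      (fun i : Fin ℓ => if (i : ℕ) < ℓ - s * d then Real.logb ℓ (d + 1) else 0)).trans ?_
    rw [Fin.sum_univ_eq_sum_range (fun i : ℕ => if i < ℓ - s * d then Real.logb ℓ (d + 1) else 0),
      ← Finset.sum_filter]
    have : (Finset.range ℓ).filter (· < ℓ - s * d) = Finset.range (ℓ - s * d) := by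
      ext i
      simp only [Finset.mem_filter, Finset.mem_range]
      omega
    rw [this]
    simp
  have hcast : (ℓ : ℝ) - s * d ≤ ((ℓ - s * d : ℕ) : ℝ) := by
    rw [sub_le_iff_le_add]
    exact_mod_cast (by omega : ℓ ≤ ℓ - s * d + s * d)
  calc (1 - (s * d : ℝ) / ℓ) * Real.logb ℓ (d + 1)
      = (1 / ℓ : ℝ) * ((ℓ - s * d) * Real.logb ℓ (d + 1)) := by field_simp
    _ ≤ (1 / ℓ : ℝ) * (((ℓ - s * d : ℕ) : ℝ) * Real.logb ℓ (d + 1)) := by gcongr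
    _ ≤ expE G := by
      rw [← hsum]
      unfold expE
      gcongr
      exact hterm _

/-- The lower bound for `Emax` in terms of `Nat.log 2 ℓ`. -/
theorem le_Emax_log {ℓ : ℕ} (hℓ : 2 ≤ ℓ) :
    (1 - 1 / ((Nat.log 2 ℓ : ℝ) + 1)) *
      (1 - 2 * Real.log ((Nat.log 2 ℓ : ℝ) + 1) / (Nat.log 2 ℓ * Real.log 2)) ≤ Emax ℓ := by
  set t := Nat.log 2 ℓ with ht
  have htpos : 0 < t := Nat.log_pos (by norm_num) hℓ
  have htR : (0 : ℝ) < t := by exact_mod_cast htpos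
  have h1 : (1 : ℝ) < ℓ := by exact_mod_cast hℓ
  have hlogℓ : 0 < Real.log ℓ := Real.log_pos h1
  set d := ℓ / (t + 1) ^ 2 with hd
  refine le_trans ?_ (le_Emax (d := d) hℓ (Nat.lt_pow_succ_log_self (by norm_num) ℓ))
  have hdle : (d : ℝ) ≤ ℓ / ((t : ℝ) + 1) ^ 2 := by
    simpa using (Nat.cast_div_le : ((ℓ / (t + 1) ^ 2 : ℕ) : ℝ) ≤ _)
  have hdge : (ℓ : ℝ) / ((t : ℝ) + 1) ^ 2 ≤ d + 1 := by
    rw [div_le_iff₀ (by positivity)]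
    exact_mod_cast (Nat.lt_mul_of_div_lt (Nat.lt_succ_self _) (by positivity) :
      ℓ < (d + 1) * (t + 1) ^ 2).le
  have hfirst : 1 - 1 / ((t : ℝ) + 1) ≤ 1 - ((t + 1 : ℕ) * d : ℝ) / ℓ := by
    rw [sub_le_sub_iff_left, div_le_div_iff₀ (by positivity) (by positivity)]
    rw [le_div_iff₀ (by positivity)] at hdle
    push_cast
    nlinarith
  have hpow : (t : ℝ) * Real.log 2 ≤ Real.log ℓ := by
    rw [← Real.log_pow]
    exact Real.log_le_log (by positivity) (by exact_mod_cast Nat.pow_log_le_self 2 (by omega))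
  have hsecond : 1 - 2 * Real.log ((t : ℝ) + 1) / (t * Real.log 2) ≤ Real.logb ℓ (d + 1) := by
    have hlt : 0 ≤ Real.log ((t : ℝ) + 1) := Real.log_nonneg (by linarith)
    calc 1 - 2 * Real.log ((t : ℝ) + 1) / (t * Real.log 2)
        ≤ 1 - 2 * Real.log ((t : ℝ) + 1) / Real.log ℓ := by
          have := Real.log_pos one_lt_two
          gcongr
      _ = Real.logb ℓ (ℓ / ((t : ℝ) + 1) ^ 2) := by
          rw [Real.logb, Real.log_div (by positivity) (by positivity), Real.log_pow]
          push_cast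
          field_simp
      _ ≤ Real.logb ℓ (d + 1) := Real.logb_le_logb_of_le h1 (by positivity) hdge
  have hnn : 0 ≤ 1 - 1 / ((t : ℝ) + 1) := by
    rw [sub_nonneg, div_le_one (by positivity)]
    linarith
  calc _ ≤ (1 - 1 / ((t : ℝ) + 1)) * Real.logb ℓ (d + 1) := by gcongr
    _ ≤ _ := by
      gcongr
      exact Real.logb_nonneg h1 (le_add_of_nonneg_left (Nat.cast_nonneg d))

open Filter Topology in
theorem tendsto_log_add_one_div_self :
    Tendsto (fun x : ℝ => Real.log (x + 1) / x) atTop (𝓝 0) := by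
  have h := (Real.isLittleO_log_id_atTop.comp_tendsto (tendsto_atTop_add_const_right atTop (1 : ℝ)
    tendsto_id)).trans_isBigO (k := fun x : ℝ => x) ?_
  · exact h.tendsto_div_nhds_zero
  · refine Asymptotics.IsBigO.of_bound 2 ?_
    filter_upwards [eventually_ge_atTop 1] with x hx
    simp only [Function.comp, id, Real.norm_eq_abs]
    rw [abs_of_nonneg (by linarith), abs_of_nonneg (by linarith)]
    linarith

/-- Lemma 10 (exponent 1 is achievable): `E_ℓ → 1` as `ℓ → ∞`. -/
theorem stmt7 : Filter.Tendsto Emax Filter.atTop (nhds 1) := by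
  have hlog : Filter.Tendsto (fun ℓ : ℕ => (Nat.log 2 ℓ : ℝ)) Filter.atTop Filter.atTop :=
    tendsto_natCast_atTop_atTop.comp (Filter.tendsto_atTop.mpr fun b =>
      (Filter.eventually_ge_atTop (2 ^ b)).mono fun _ h => Nat.le_log_of_pow_le (by norm_num) h)
  have hreal : Filter.Tendsto (fun x : ℝ => (1 - 1 / (x + 1)) *
      (1 - 2 * Real.log (x + 1) / (x * Real.log 2))) Filter.atTop (nhds 1) := by
    have h1 : Filter.Tendsto (fun x : ℝ => 1 / (x + 1)) Filter.atTop (nhds 0) := by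
      simp only [one_div]
      exact (Filter.tendsto_atTop_add_const_right Filter.atTop (1 : ℝ)
        Filter.tendsto_id).inv_tendsto_atTop
    have h2 : Filter.Tendsto (fun x : ℝ => 2 * Real.log (x + 1) / (x * Real.log 2))
        Filter.atTop (nhds 0) := by
      have := tendsto_log_add_one_div_self.const_mul (2 / Real.log 2)
      rw [mul_zero] at this
      refine this.congr fun x => ?_
      ring
    simpa using (h1.const_sub 1).mul (h2.const_sub 1)
  refine tendsto_of_tendsto_of_tendsto_of_le_of_le' (hreal.comp hlog) tendsto_const_nhds ?_ ?_
  · filter_upwards [Filter.eventually_ge_atTop 2] with ℓ hℓ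
    exact le_Emax_log hℓ
  · filter_upwards [Filter.eventually_ge_atTop 2] with ℓ hℓ
    refine Real.sSup_le ?_ zero_le_one
    rintro _ ⟨G, -, rfl⟩
    exact expE_le_one hℓ G
end

section
/- For every ℓ with 2 ≤ ℓ ≤ 14 and every invertible ℓ×ℓ matrix G over GF(2) with partial distances D_1,…,D_ℓ, one has (∏_{i=1}^ℓ D_i)² ≤ ℓ^ℓ; equivalently, E(G) ≤ 1/2. That is, no matrix of size less than 15 has exponent exceeding 1/2. -/
/-- Coefficientwise sum of two coefficient lists. -/
def addCoeffs : List ℤ → List ℤ → List ℤ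
  | [], l => l
  | a :: k, [] => a :: k
  | a :: k, b :: l => (a + b) :: addCoeffs k l

/-- Coefficientwise absolute value. -/
def absCoeffs (l : List ℤ) : List ℤ := l.map fun a => (a.natAbs : ℤ)

/-- Dot product of two coefficient lists. -/
def dotCoeffs : List ℤ → List ℤ → ℤ
  | a :: k, b :: l => a * b + dotCoeffs k l
  | _, _ => 0

/-- Multiplication of a coefficient list by `1 + a X`. -/
def mulOneAdd (a : ℤ) (l : List ℤ) : List ℤ := addCoeffs l (0 :: l.map (a * ·))

/-- The coefficients of `(1 - X) ^ w * (1 + X) ^ v`: the values at weight `w` of the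
Krawtchouk polynomials of length `w + v`. -/
def krawtchoukRow (w v : ℕ) : List ℤ := (mulOneAdd (-1))^[w] ((mulOneAdd 1)^[v] [1])

/-- An upper bound for all the entries of a list. -/
def maxEntry : List ℤ → ℤ
  | [] => 0
  | [a] => a
  | a :: b :: l => max a (maxEntry (b :: l))

/-- The value of a dual linear programming certificate for a chain of binary codes of length `n`.
The entry `(p, x)` at height `k` holds the lower bound `p` for the weights of the words in the
`(k+1)`-st code but not in the `k`-th, and the multipliers `x` of the inequalities comparing the
Krawtchouk sums over these words with those over the `k`-th code. -/
def dualBound (n : ℕ) : List ℤ → List (ℕ × List ℤ) → ℤ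
  | A, [] => dotCoeffs A (krawtchoukRow 0 n)
  | A, (p, x) :: r =>
    dualBound n (addCoeffs A (absCoeffs x)) r + 2 ^ r.length *
      maxEntry (((List.range (n + 1)).drop p).map fun w =>
        dotCoeffs (addCoeffs A x) (krawtchoukRow w (n - w)))

/-- All sums of sublists of a list of binary words. -/
def words {ι : Type*} : List (ι → ZMod 2) → List (ι → ZMod 2)
  | [] => [0]
  | b :: bs => words bs ++ (words bs).map (b + ·)

/-- The list `[b (k - 1), …, b 0]`. -/
def firstRows {ι : Type*} (b : ℕ → ι → ZMod 2) : ℕ → List (ι → ZMod 2)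
  | 0 => []
  | k + 1 => b k :: firstRows b k

/-- The words `b 0, …, b (n - 1)` span a chain of codes in which each word of the `(k+1)`-st code
that is not in the `k`-th one has weight at least `d k`. -/
def IsDistanceChain {n : ℕ} (b : ℕ → Fin n → ZMod 2) (d : ℕ → ℕ) : Prop :=
  ∀ k < n, ∀ c ∈ words (firstRows b k), d k ≤ hammingNorm (b k + c)

section Coefficients

lemma dotCoeffs_addCoeffs : ∀ a b r : List ℤ,
    dotCoeffs (addCoeffs a b) r = dotCoeffs a r + dotCoeffs b r
  | [], b, r => by simp [addCoeffs, dotCoeffs]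
  | a :: k, [], r => by simp [addCoeffs, dotCoeffs]
  | a :: k, b :: l, [] => by simp [dotCoeffs]
  | a :: k, b :: l, c :: r => by
    simp only [addCoeffs, dotCoeffs, dotCoeffs_addCoeffs k l r]; ring

lemma getD_addCoeffs : ∀ (a b : List ℤ) (j : ℕ),
    (addCoeffs a b).getD j 0 = a.getD j 0 + b.getD j 0
  | [], b, j => by simp [addCoeffs]
  | a :: k, [], j => by simp [addCoeffs]
  | a :: k, b :: l, 0 => by simp [addCoeffs]
  | a :: k, b :: l, j + 1 => by simpa [addCoeffs] using getD_addCoeffs k l j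

lemma dotCoeffs_eq_sum : ∀ x r : List ℤ,
    dotCoeffs x r = ∑ j ∈ Finset.range x.length, x.getD j 0 * r.getD j 0
  | [], r => by simp [dotCoeffs]
  | a :: k, [] => by simp [dotCoeffs]
  | a :: k, b :: l => by
    rw [List.length_cons, Finset.sum_range_succ', dotCoeffs, dotCoeffs_eq_sum k l]
    simp [add_comm]

lemma getD_absCoeffs (x : List ℤ) (j : ℕ) : (absCoeffs x).getD j 0 = |x.getD j 0| := by
  rcases lt_or_ge j x.length with h | h
  · simp [absCoeffs, h]
  · simp [absCoeffs, h]

lemma le_maxEntry : ∀ {l : List ℤ} {a : ℤ}, a ∈ l → a ≤ maxEntry l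
  | [b], a, h => by simpa [maxEntry] using (List.mem_singleton.1 h).le
  | b :: c :: l, a, h => by
    rcases List.mem_cons.1 h with rfl | h
    · exact le_max_left _ _
    · exact (le_maxEntry h).trans (le_max_right _ _)

lemma getD_mulOneAdd {l : List ℤ} {s : Multiset ℤ} (h : ∀ j, l.getD j 0 = s.esymm j) (a : ℤ)
    (j : ℕ) : (mulOneAdd a l).getD j 0 = (a ::ₘ s).esymm j := by
  rw [mulOneAdd, getD_addCoeffs]
  cases j with
  | zero => rw [h]; simp [Multiset.esymm]
  | succ j =>
    have h' : (l.map (a * ·)).getD j 0 = a * l.getD j 0 := by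
      rcases lt_or_ge j l.length with hj | hj <;> simp [hj]
    rw [List.getD_cons_succ, h', h, h]
    simp [Multiset.esymm, Multiset.powersetCard_cons, Multiset.map_map,
      Multiset.sum_map_mul_left]

lemma getD_krawtchoukRow (w v j : ℕ) : (krawtchoukRow w v).getD j 0 =
    (Multiset.replicate w (-1 : ℤ) + Multiset.replicate v 1).esymm j := by
  induction w generalizing j with
  | zero =>
    induction v generalizing j with
    | zero =>
      cases j with
      | zero => simp [krawtchoukRow, Multiset.esymm]
      | succ j => simp [krawtchoukRow, Multiset.esymm, Multiset.powersetCard_zero_right]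
    | succ v ih =>
      have := getD_mulOneAdd ih 1 j
      simpa [krawtchoukRow, Function.iterate_succ_apply', Multiset.replicate_succ] using this
  | succ w ih =>
    have := getD_mulOneAdd ih (-1) j
    simpa [krawtchoukRow, Function.iterate_succ_apply', Multiset.replicate_succ] using this

end Coefficients

section Characters

variable {ι : Type*}

/-- The nontrivial additive character of `ZMod 2`. -/
def bitSign (x : ZMod 2) : ℤ := if x = 0 then 1 else -1

lemma bitSign_add : ∀ x y : ZMod 2, bitSign (x + y) = bitSign x * bitSign y := by decide

lemma abs_bitSign : ∀ x : ZMod 2, |bitSign x| = 1 := by decide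

lemma sum_prod_bitSign_nonneg (t : Finset ι) (bs : List (ι → ZMod 2)) :
    0 ≤ ((words bs).map fun c => ∏ i ∈ t, bitSign (c i)).sum := by
  induction bs with
  | nil => simp [words, bitSign]
  | cons b bs ih =>
    have h1 : |∏ i ∈ t, bitSign (b i)| = 1 := by simp [Finset.abs_prod, abs_bitSign]
    simp only [words, List.map_append, List.sum_append, List.map_map, Function.comp_def,
      Pi.add_apply, bitSign_add, Finset.prod_mul_distrib, List.sum_map_mul_left]
    rcases eq_or_eq_neg_of_abs_eq h1 with h | h <;> rw [h] <;> linarith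

lemma abs_sum_prod_bitSign_add (t : Finset ι) (b : ι → ZMod 2) (bs : List (ι → ZMod 2)) :
    |((words bs).map fun c => ∏ i ∈ t, bitSign ((b + c) i)).sum| =
      ((words bs).map fun c => ∏ i ∈ t, bitSign (c i)).sum := by
  simp only [Pi.add_apply, bitSign_add, Finset.prod_mul_distrib, List.sum_map_mul_left, abs_mul,
    Finset.abs_prod, abs_bitSign, Finset.prod_const_one, one_mul]
  exact abs_of_nonneg (sum_prod_bitSign_nonneg t bs)

lemma sum_map_finset_sum {α κ : Type*} (L : List α) (s : Finset κ) (f : α → κ → ℤ) :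
    (L.map fun c => ∑ j ∈ s, f c j).sum = ∑ j ∈ s, (L.map fun c => f c j).sum := by
  induction L with
  | nil => simp
  | cons a L ih => simp [ih, Finset.sum_add_distrib]

lemma krawtchoukRow_hammingNorm {n : ℕ} (c : Fin n → ZMod 2) (j : ℕ) :
    (krawtchoukRow (hammingNorm c) (n - hammingNorm c)).getD j 0 =
      ∑ t ∈ Finset.powersetCard j Finset.univ, ∏ i ∈ t, bitSign (c i) := by
  rw [getD_krawtchoukRow, ← Finset.esymm_map_val]
  congr 1
  have hsplit := Multiset.filter_add_not (fun i => c i ≠ 0) (Finset.univ : Finset (Fin n)).val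
  rw [← hsplit, Multiset.map_add]
  have hcard : (Finset.univ.filter fun i => ¬ c i ≠ 0).card = n - hammingNorm c := by
    have := Finset.card_filter_add_card_filter_not (s := Finset.univ) (fun i : Fin n => c i ≠ 0)
    simp only [Finset.card_univ, Fintype.card_fin] at this
    simp only [hammingNorm]
    omega
  congr 1
  · symm
    rw [Multiset.eq_replicate]
    refine ⟨by rw [Multiset.card_map]; rfl, fun a ha => ?_⟩
    obtain ⟨i, hi, rfl⟩ := Multiset.mem_map.1 ha
    simp [bitSign, (Multiset.mem_filter.1 hi).2]
  · symm
    rw [Multiset.eq_replicate]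
    refine ⟨by rw [Multiset.card_map, ← hcard]; rfl, fun a ha => ?_⟩
    obtain ⟨i, hi, rfl⟩ := Multiset.mem_map.1 ha
    simp [bitSign, not_not.1 (Multiset.mem_filter.1 hi).2]

/-- The linear functional of the weight of a word with coefficients `A` in the Krawtchouk basis. -/
def weightFunctional {n : ℕ} (A : List ℤ) (c : Fin n → ZMod 2) : ℤ :=
  dotCoeffs A (krawtchoukRow (hammingNorm c) (n - hammingNorm c))

lemma sum_weightFunctional {n : ℕ} (x : List ℤ) (L : List (Fin n → ZMod 2))
    (f : (Fin n → ZMod 2) → Fin n → ZMod 2) :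
    (L.map fun c => weightFunctional x (f c)).sum =
      ∑ j ∈ Finset.range x.length, ∑ t ∈ Finset.powersetCard j Finset.univ,
        x.getD j 0 * (L.map fun c => ∏ i ∈ t, bitSign (f c i)).sum := by
  simp only [weightFunctional, dotCoeffs_eq_sum, krawtchoukRow_hammingNorm, Finset.mul_sum,
    sum_map_finset_sum, List.sum_map_mul_left]

lemma sum_weightFunctional_coset_nonneg {n : ℕ} (x : List ℤ) (b : Fin n → ZMod 2)
    (bs : List (Fin n → ZMod 2)) :
    0 ≤ ((words bs).map fun c => weightFunctional (absCoeffs x) c).sum +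
      ((words bs).map fun c => weightFunctional x (b + c)).sum := by
  rw [sum_weightFunctional _ _ fun c => c, sum_weightFunctional, absCoeffs, List.length_map,
    ← absCoeffs, ← Finset.sum_add_distrib]
  refine Finset.sum_nonneg fun j _ => ?_
  rw [← Finset.sum_add_distrib]
  refine Finset.sum_nonneg fun t _ => ?_
  rw [getD_absCoeffs, ← abs_sum_prod_bitSign_add t b bs, ← abs_mul]
  linarith [neg_abs_le (x.getD j 0 *
    ((words bs).map fun c => ∏ i ∈ t, bitSign ((b + c) i)).sum)]

lemma length_words (bs : List (ι → ZMod 2)) : (words bs).length = 2 ^ bs.length := by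
  induction bs with
  | nil => rfl
  | cons b bs ih => simp [words, ih, pow_succ, mul_two]

lemma length_firstRows (b : ℕ → ι → ZMod 2) (k : ℕ) : (firstRows b k).length = k := by
  induction k with
  | zero => rfl
  | succ k ih => simp [firstRows, ih]

end Characters

section Duality

variable {n : ℕ} {b : ℕ → Fin n → ZMod 2} {d : ℕ → ℕ}

/-- `DominatesFrom d i [p₀, p₁, …]` says that `p₀ ≤ d i`, `p₁ ≤ d (i + 1)`, …. -/
def DominatesFrom (d : ℕ → ℕ) : ℕ → List ℕ → Prop
  | _, [] => True
  | i, p :: l => p ≤ d i ∧ DominatesFrom d (i + 1) l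

lemma dominatesFrom_append (d : ℕ → ℕ) : ∀ (i : ℕ) (l m : List ℕ),
    DominatesFrom d i (l ++ m) ↔ DominatesFrom d i l ∧ DominatesFrom d (i + l.length) m
  | i, [], m => by simp [DominatesFrom]
  | i, p :: l, m => by
    simp [DominatesFrom, dominatesFrom_append d (i + 1) l m, and_assoc, add_assoc, add_comm 1]

lemma sum_weightFunctional_le_dualBound (hb : IsDistanceChain b d) :
    ∀ (q : List (ℕ × List ℤ)) (A : List ℤ), q.length ≤ n →
      DominatesFrom d 0 (q.map Prod.fst).reverse →
      ((words (firstRows b q.length)).map fun c => weightFunctional A c).sum ≤ dualBound n A q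
  | [], A, _, _ => by simp [firstRows, words, weightFunctional, dualBound]
  | (p, x) :: r, A, hq, hd => by
    rw [List.map_cons, List.reverse_cons, dominatesFrom_append] at hd
    obtain ⟨hd, hp, -⟩ := hd
    simp only [List.length_reverse, List.length_map, zero_add] at hp
    rw [List.length_cons] at hq
    have ih := sum_weightFunctional_le_dualBound hb r (addCoeffs A (absCoeffs x)) (by omega) hd
    have hx := sum_weightFunctional_coset_nonneg x (b r.length) (firstRows b r.length)
    have hmax : ((words (firstRows b r.length)).map fun c =>
        weightFunctional (addCoeffs A x) (b r.length + c)).sum ≤ 2 ^ r.length *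
        maxEntry (((List.range (n + 1)).drop p).map fun w =>
          dotCoeffs (addCoeffs A x) (krawtchoukRow w (n - w))) := by
      have hle : ∀ y ∈ (words (firstRows b r.length)).map fun c =>
          weightFunctional (addCoeffs A x) (b r.length + c),
          y ≤ maxEntry (((List.range (n + 1)).drop p).map fun w =>
            dotCoeffs (addCoeffs A x) (krawtchoukRow w (n - w))) := by
        intro y hy
        obtain ⟨c, hc, rfl⟩ := List.mem_map.1 hy
        refine le_maxEntry (List.mem_map.2 ⟨hammingNorm (b r.length + c), ?_, rfl⟩)
        have h1 := hb r.length (by omega) c hc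
        have h2 : hammingNorm (b r.length + c) ≤ n := by
          simpa using hammingNorm_le_card_fintype (x := b r.length + c)
        rw [List.mem_drop_iff_getElem]
        exact ⟨hammingNorm (b r.length + c) - p, by simp; omega, by simp; omega⟩
      have hsum := List.sum_le_card_nsmul _ _ hle
      rwa [List.length_map, length_words, length_firstRows, nsmul_eq_mul, Nat.cast_pow,
        Nat.cast_ofNat] at hsum
    simp only [weightFunctional, dotCoeffs_addCoeffs, List.sum_map_add] at ih hx hmax ⊢
    simp only [List.length_cons, firstRows, words, List.map_append, List.sum_append, List.map_map,
      Function.comp_def, dualBound]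
    simp only [dotCoeffs_addCoeffs] at hmax ⊢
    linarith

lemma not_dominatesFrom_of_dualBound_neg (hb : IsDistanceChain b d) {q : List (ℕ × List ℤ)}
    (hq : q.length ≤ n) (hneg : dualBound n [] q < 0) :
    ¬ DominatesFrom d 0 (q.map Prod.fst).reverse := fun h => by
  have := sum_weightFunctional_le_dualBound hb q [] hq h
  simp [weightFunctional, dotCoeffs] at this
  omega

end Duality

section Search

/-- The tail of a pattern if its head is at most `v`. -/
def advance (v : ℕ) : List ℕ → Option (List ℕ)
  | [] => none
  | p :: l => if p ≤ v then some l else none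

/-- The product of the entries of a list capped by `v`. -/
def cappedProd (v : ℕ) : List ℕ → ℕ
  | [] => 1
  | u :: us => min v u * cappedProd v us

/-- Exhaustive search over the antitone sequences bounded by `v` and by a list and not dominating
any of some patterns, checking that `p` times their product has square at most `B`. -/
def productSearch (B : ℕ) : List ℕ → ℕ → ℕ → List (List ℕ) → Bool
  | [], _, p, _ => decide (p ^ 2 ≤ B)
  | u :: us, v, p, pats => decide ((p * cappedProd v (u :: us)) ^ 2 ≤ B) ||
      (List.range (min v u)).all fun w =>
        (pats.filterMap (advance (w + 1))).any List.isEmpty ||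
          productSearch B us (w + 1) (p * (w + 1)) (pats.filterMap (advance (w + 1)))

lemma dominatesFrom_of_mem_filterMap_advance {d : ℕ → ℕ} {i : ℕ} {pats : List (List ℕ)} {l : List ℕ}
    (hl : l ∈ pats.filterMap (advance (d i))) (h : DominatesFrom d (i + 1) l) :
    ∃ m ∈ pats, DominatesFrom d i m := by
  obtain ⟨m, hm, hml⟩ := List.mem_filterMap.1 hl
  refine ⟨m, hm, ?_⟩
  cases m with
  | nil => simp [advance] at hml
  | cons p m =>
    simp only [advance, Option.ite_none_right_eq_some, Option.some.injEq] at hml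
    exact ⟨hml.1, hml.2 ▸ h⟩

lemma prod_le_cappedProd {d : ℕ → ℕ} {v : ℕ} : ∀ (us : List ℕ) (i : ℕ),
    (∀ j < us.length, d (i + j) ≤ v ∧ d (i + j) ≤ us.getD j 0) →
      ∏ j ∈ Finset.range us.length, d (i + j) ≤ cappedProd v us
  | [], i, _ => by simp [cappedProd]
  | u :: us, i, h => by
    rw [List.length_cons, Finset.prod_range_succ', cappedProd, mul_comm]
    refine Nat.mul_le_mul ?_ ?_
    · simpa using h 0 (by simp)
    · have := prod_le_cappedProd (v := v) (d := d) us (i + 1) fun j hj => by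
        simpa [add_assoc, add_comm 1] using h (j + 1) (by simpa using hj)
      simpa [add_assoc, add_comm 1] using this

lemma sq_prod_le_of_productSearch {B : ℕ} {d : ℕ → ℕ} : ∀ (us : List ℕ) (i v p : ℕ)
    (pats : List (List ℕ)),
    (∀ j < us.length, 1 ≤ d (i + j) ∧ d (i + j) ≤ v ∧ d (i + j) ≤ us.getD j 0) →
    (∀ j k, j ≤ k → k < us.length → d (i + k) ≤ d (i + j)) →
    (∀ l ∈ pats, ¬ DominatesFrom d i l) → productSearch B us v p pats = true →
      (p * ∏ j ∈ Finset.range us.length, d (i + j)) ^ 2 ≤ B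
  | [], i, v, p, pats, _, _, _, hs => by simpa [productSearch] using hs
  | u :: us, i, v, p, pats, hd, hanti, hpats, hs => by
    rw [productSearch, Bool.or_eq_true, decide_eq_true_eq] at hs
    rcases hs with hs | hs
    · refine le_trans (Nat.pow_le_pow_left (Nat.mul_le_mul_left p ?_) 2) hs
      exact prod_le_cappedProd (u :: us) i fun j hj => (hd j hj).2
    · have h0 := hd 0 (by simp)
      simp only [add_zero, List.getD_cons_zero] at h0
      rw [List.all_eq_true] at hs
      have hs := hs (d i - 1) (List.mem_range.2 (by omega))
      rw [Nat.sub_add_cancel h0.1, Bool.or_eq_true] at hs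
      have hpats' : ∀ l ∈ pats.filterMap (advance (d i)), ¬ DominatesFrom d (i + 1) l := by
        intro l hl h
        obtain ⟨m, hm, hmd⟩ := dominatesFrom_of_mem_filterMap_advance hl h
        exact hpats m hm hmd
      rcases hs with hs | hs
      · obtain ⟨l, hl, hle⟩ := List.any_eq_true.1 hs
        rw [List.isEmpty_iff] at hle
        exact absurd (by rw [hle]; trivial) (hpats' l hl)
      · have := sq_prod_le_of_productSearch us (i + 1) (d i) (p * d i) _
          (fun j hj => by
            have h1 := hd (j + 1) (by simpa using hj)
            have h2 := hanti 0 (j + 1) (by simp) (by simpa using hj)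
            rw [add_assoc, add_comm 1]
            exact ⟨h1.1, by simpa using h2, by simpa using h1.2.2⟩)
          (fun j k hjk hk => by
            rw [add_assoc, add_assoc, add_comm 1, add_comm 1]
            exact hanti (j + 1) (k + 1) (by omega) (by simpa using hk)) hpats' hs
        rw [List.length_cons, Finset.prod_range_succ', mul_comm (∏ j ∈ _, _), ← mul_assoc]
        simpa [add_assoc, add_comm 1] using this

lemma dominatesFrom_of_forall_le {d : ℕ → ℕ} : ∀ (l : List ℕ) (i : ℕ),
    (∀ p ∈ l, ∀ j < l.length, p ≤ d (i + j)) → DominatesFrom d i l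
  | [], _, _ => trivial
  | p :: l, i, h => ⟨by simpa using h p (by simp) 0 (by simp),
      dominatesFrom_of_forall_le l (i + 1) fun q hq j hj => by
        simpa [add_assoc, add_comm 1] using
          h q (List.mem_cons_of_mem _ hq) (j + 1) (by simpa using hj)⟩

end Search

/-- Upper bounds for the successive minimum distances in a chain of codes of length `n`. -/
def distanceBounds : ℕ → List ℕ
  | 2 => [2, 1]
  | 3 => [3, 2, 1]
  | 4 => [4, 2, 2, 1]
  | 5 => [5, 3, 2, 2, 1]
  | 6 => [6, 4, 3, 2, 2, 1]
  | 7 => [7, 4, 4, 3, 2, 2, 1]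
  | 8 => [8, 5, 4, 4, 2, 2, 2, 1]
  | 9 => [9, 6, 4, 4, 3, 2, 2, 2, 1]
  | 10 => [10, 6, 5, 4, 4, 3, 2, 2, 2, 1]
  | 11 => [11, 7, 6, 5, 4, 4, 3, 2, 2, 2, 1]
  | 12 => [12, 8, 6, 6, 5, 4, 4, 3, 2, 2, 2, 1]
  | 13 => [13, 8, 7, 6, 5, 5, 4, 4, 3, 2, 2, 2, 1]
  | 14 => [14, 9, 8, 7, 6, 5, 5, 4, 4, 3, 2, 2, 2, 1]
  | _ => []

/-- Dual certificates excluding patterns of minimum distances in chains of codes of length `n`. -/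
def dualCertificates : ℕ → List (List (ℕ × List ℤ))
  | 2 => [
      [(2, [0, 1]), (2, [])]]
  | 3 => [
      [(3, [0, 1]), (3, [])],
      [(2, [0, 1]), (2, []), (2, [])],
      [(2, [0, 1, 0, -1]), (3, [])]]
  | 4 => [
      [(3, [0, 1, 0, 0, 1]), (3, [])],
      [(3, [0, 1, 0, 0, 1]), (3, []), (3, [])],
      [(2, [0, 2, 1, 1]), (2, []), (2, []), (2, [])]]
  | 5 => [
      [(4, [0, 1]), (4, [])],
      [(3, [0, 1, 0, 0, 0, 1]), (3, []), (3, [])],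
      [(3, [0, 1, 0, 0, 0, 1]), (3, []), (3, []), (3, [])],
      [(2, [0, 2, 1, 1]), (2, []), (2, []), (2, []), (2, [])],
      [(2, [0, 3, 1, 0, -1, -3]), (2, [0, 0, 0, 0, -1, -5]), (3, [0, 3]), (3, [])]]
  | 6 => [
      [(5, [0, 1, 0, 0, 0, 0, 1]), (5, [])],
      [(4, [0, 1]), (4, []), (4, [])],
      [(3, [0, 1, 0, 0, 0, 0, 1]), (3, []), (3, []), (3, [])],
      [(3, [0, 1, 0, 0, 0, 0, 1]), (3, []), (3, []), (3, []), (3, [])],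
      [(2, [0, 2, 1, 1]), (2, []), (2, []), (2, []), (2, []), (2, [])],
      [(3, [0, 1, 0, 0, 0, 0, 1]), (3, []), (5, [])]]
  | 7 => [
      [(5, [0, 1, 0, 0, 0, 0, 0, 1]), (5, [])],
      [(5, [0, 1, 0, 0, 0, 0, 0, 1]), (5, []), (5, [])],
      [(4, [0, 1]), (4, []), (4, []), (4, [])],
      [(3, [0, 1, 0, 0, 0, 0, 1, 1]), (3, []), (3, []), (3, []), (3, [])],
      [(3, [0, 3, 1, 0, 0, 0, 0, 3]), (3, []), (3, []), (3, []), (3, []), (3, [])],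
      [(2, [0, 3, 2, 2, 1, 1]), (2, []), (2, []), (2, []), (2, []), (2, []), (2, [])],
      [(2, [0, 3, 2, 1, 0, -1, -2, -3]), (3, [0, 6, 2, 0, 0, 0, 2, 6]), (3, []), (3, []),
        (3, [])]]
  | 8 => [
      [(6, [0, 1]), (6, [])],
      [(5, [0, 1, 0, 0, 0, 0, 0, 0, 1]), (5, []), (5, [])],
      [(5, [0, 1, 0, 0, 0, 0, 0, 0, 1]), (5, []), (5, []), (5, [])],
      [(3, [0, 5, 2, 1, 0, 0, 1, 2, 5]), (3, []), (3, []), (3, []), (3, [])],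
      [(3, [0, 4, 2, 1, 0, 0, 1, 2, 4]), (3, []), (3, []), (3, []), (3, []), (3, [])],
      [(3, [0, 3, 1, 0, 0, 0, 0, 1, 3]), (3, []), (3, []), (3, []), (3, []), (3, []), (3,
        [])],
      [(2, [0, 8, 6, 5, 4, 3, 2]), (2, []), (2, []), (2, []), (2, []), (2, []), (2, []), (2,
        [])],
      [(4, [0, 1, 0, 0, 0, 0, 0, 0, -1]), (5, []), (5, [])]]
  | 9 => [
      [(7, [0, 1, 0, 0, 0, 0, 0, 0, 0, 1]), (7, [])],
      [(5, [0, 1, 0, 0, 0, 0, 0, 0, 0, 1]), (5, []), (5, [])],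
      [(5, [0, 1, 0, 0, 0, 0, 0, 0, 0, 1]), (5, []), (5, []), (5, [])],
      [(4, [0, 5, 2, 1]), (4, []), (4, []), (4, []), (4, [])],
      [(3, [0, 4, 2, 1, 0, 0, 0, 1, 2, 4]), (3, []), (3, []), (3, []), (3, []), (3, [])],
      [(3, [0, 4, 2, 1, 0, 0, 0, 1, 2, 4]), (3, []), (3, []), (3, []), (3, []), (3, []), (3,
        [])],
      [(3, [0, 3, 1, 1, 0, 0, 0, 1, 1, 3]), (3, []), (3, []), (3, []), (3, []), (3, []), (3,
        []), (3, [])],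
      [(2, [0, 4, 3, 3, 2, 2, 1, 1]), (2, []), (2, []), (2, []), (2, []), (2, []), (2, []),
        (2, []), (2, [])],
      [(6, [0, 1, 0, 0, 0, 0, 0, 0, 0, -1]), (7, [])]]
  | 10 => [
      [(7, [0, 1, 0, 0, 0, 0, 0, 0, 0, 0, 1]), (7, [])],
      [(6, [0, 1]), (6, []), (6, [])],
      [(5, [0, 1, 0, 0, 0, 0, 0, 0, 0, 0, 1]), (5, []), (5, []), (5, [])],
      [(5, [0, 1, 0, 0, 0, 0, 0, 0, 0, 0, 1]), (5, []), (5, []), (5, []), (5, [])],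
      [(4, [0, 8, 3, 2, 0, 0, 0, 0, 1]), (4, []), (4, []), (4, []), (4, []), (4, [])],
      [(3, [0, 3, 1, 1, 0, 0, 0, 0, 1, 1, 3]), (3, []), (3, []), (3, []), (3, []), (3, []),
        (3, [])],
      [(3, [0, 3, 1, 1, 0, 0, 0, 0, 1, 1, 3]), (3, []), (3, []), (3, []), (3, []), (3, []),
        (3, []), (3, [])],
      [(3, [0, 3, 1, 1, 0, 0, 0, 0, 1, 1, 3]), (3, []), (3, []), (3, []), (3, []), (3, []),
        (3, []), (3, []), (3, [])],
      [(2, [0, 12, 9, 9, 7, 6, 5, 3, 2]), (2, []), (2, []), (2, []), (2, []), (2, []), (2,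
        []), (2, []), (2, []), (2, [])],
      [(2, [0, 5, 4, 3, 2, 1, 0, -1, -2, -3, -4]), (2, [0, 0, 0, 0, 0, 0, 0, -2, -4, -6,
        -8]), (2, [0, 0, 0, 0, 0, 0, 0, -4, -8, -12, -15]), (3, [0, 31, 15, 8, 0, 0, 0, 0,
        0, 8, 15]), (3, []), (3, []), (3, []), (3, []), (3, [])]]
  | 11 => [
      [(8, [0, 1]), (8, [])],
      [(7, [0, 1, 0, 0, 0, 0, 0, 0, 0, 0, 0, 1]), (7, []), (7, [])],
      [(6, [0, 1]), (6, []), (6, []), (6, [])],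
      [(5, [0, 1, 0, 0, 0, 0, 0, 0, 0, 0, 1, 1]), (5, []), (5, []), (5, []), (5, [])],
      [(5, [0, 1, 0, 0, 0, 0, 0, 0, 0, 0, 1, 1]), (5, []), (5, []), (5, []), (5, []), (5,
        [])],
      [(4, [0, 10, 4, 2, 0, 0, 0, 1, 1, 2]), (4, []), (4, []), (4, []), (4, []), (4, []),
        (4, [])],
      [(3, [0, 3, 1, 1, 0, 0, 0, 0, 1, 1, 3, 3]), (3, []), (3, []), (3, []), (3, []), (3,
        []), (3, []), (3, [])],
      [(3, [0, 3, 1, 1, 0, 0, 0, 0, 1, 1, 3, 3]), (3, []), (3, []), (3, []), (3, []), (3,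
        []), (3, []), (3, []), (3, [])],
      [(3, [0, 3, 1, 1, 0, 0, 0, 0, 1, 1, 3, 3]), (3, []), (3, []), (3, []), (3, []), (3,
        []), (3, []), (3, []), (3, []), (3, [])],
      [(2, [0, 14, 13, 12, 10, 8, 6, 4, 2, 1]), (2, []), (2, []), (2, []), (2, []), (2, []),
        (2, []), (2, []), (2, []), (2, []), (2, [])],
      [(2, [0, 12, 9, 8, 5, 4, 1, 0, -3, -4, -7, -8]), (2, [0, 0, 0, 0, 0, 0, 0, 0, -6, -8,
        -14, -16]), (2, [0, 4, 4, 2, 2, 0, 0, -2, -14, -20, -32, -37]), (3, [0, 87, 39, 28,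
        4, 0, 0, 0, 0, 0, 24, 32]), (3, []), (3, []), (3, []), (3, []), (3, []), (3, [])],
      [(7, [0, 1, 0, 0, 0, 0, 0, 0, 0, 0, 0, 1]), (9, [])]]
  | 12 => [
      [(9, [0, 1, 0, 0, 0, 0, 0, 0, 0, 0, 0, 0, 1]), (9, [])],
      [(7, [0, 1, 0, 0, 0, 0, 0, 0, 0, 0, 0, 0, 1]), (7, []), (7, [])],
      [(7, [0, 1, 0, 0, 0, 0, 0, 0, 0, 0, 0, 0, 1]), (7, []), (7, []), (7, [])],
      [(6, [0, 6, 0, 0, 0, 0, 0, 0, 0, 0, 1]), (6, []), (6, []), (6, []), (6, [])],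
      [(5, [0, 6, 2, 1, 0, 0, 0, 0, 0, 0, 0, 1, 4]), (5, []), (5, []), (5, []), (5, []), (5,
        [])],
      [(5, [0, 8, 3, 1, 0, 0, 0, 0, 0, 0, 1, 3, 8]), (5, []), (5, []), (5, []), (5, []), (5,
        []), (5, [])],
      [(4, [0, 21, 12, 7, 3, 1, 0, 0, 0, 1, 1]), (4, []), (4, []), (4, []), (4, []), (4,
        []), (4, []), (4, [])],
      [(3, [0, 14, 9, 6, 3, 1, 0, 0, 1, 3, 6, 9, 14]), (3, []), (3, []), (3, []), (3, []),
        (3, []), (3, []), (3, []), (3, [])],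
      [(3, [0, 10, 6, 4, 2, 1, 0, 0, 1, 2, 4, 6, 10]), (3, []), (3, []), (3, []), (3, []),
        (3, []), (3, []), (3, []), (3, []), (3, [])],
      [(3, [0, 10, 6, 4, 2, 1, 0, 0, 1, 2, 4, 6, 10]), (3, []), (3, []), (3, []), (3, []),
        (3, []), (3, []), (3, []), (3, []), (3, []), (3, [])],
      [(2, [0, 5, 4, 4, 3, 3, 2, 2, 1, 1]), (2, []), (2, []), (2, []), (2, []), (2, []), (2,
        []), (2, []), (2, []), (2, []), (2, []), (2, [])],
      [(2, [0, 7, 6, 5, 4, 3, 2, 1, 0, -1, -2, -3, -4]), (2, [0, 0, 0, 0, 0, 0, 0, 0, 0, -2,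
        -4, -6, -8]), (2, [0, 12, 8, 8, 4, 4, 0, 0, -4, -8, -16, -19, -27]), (3, [0, 47, 31,
        16, 8, 0, 0, 0, 0, 0, 0, 8, 16]), (3, []), (3, []), (3, []), (3, []), (3, []), (3,
        []), (3, [])],
      [(2, [0, 5, 4, 4, 3, 3, 2, 2, 1, 1, 0, 0, -1]), (2, [0, 0, 0, 0, 0, 0, 0, 0, 0, 0, 0,
        0, -2]), (2, [0, 0, 0, 0, 0, 0, 0, 0, 0, 0, 0, 0, -4]), (2, [0, 0, 0, 0, 0, 0, 0, 0,
        0, 0, 0, 0, -7]), (2, [0, 0, 0, 0, 0, 0, 0, 0, 0, 0, 0, 0, -15]), (2, [0, 0, 0, 0,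
        0, 0, 0, 0, 0, 0, 0, 0, -29]), (2, [0, 0, 0, 0, 0, 0, 0, 0, 0, 0, 0, 0, -58]), (2,
        [0, 0, 0, 0, 0, 0, 0, 0, 0, 0, 0, 0, -117]), (2, [0, 0, 0, 0, 0, 0, 0, 0, 0, 0, 0,
        0, -234]), (7, [0, 468]), (9, [])],
      [(4, [0, 12, 4, 3, 0, 0, 0, 0, 0, 0, -2, -3, -13]), (4, [0, 0, 0, 0, 0, 0, 0, 0, 0, 0,
        -4, -6, -25]), (5, [0, 22, 7, 0, 0, 0, 0, 0, 0, 0, 0, 9]), (5, []), (5, []), (5,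
        []), (5, [])]]
  | 13 => [
      [(9, [0, 1, 0, 0, 0, 0, 0, 0, 0, 0, 0, 0, 0, 1]), (9, [])],
      [(8, [0, 1]), (8, []), (8, [])],
      [(7, [0, 1, 0, 0, 0, 0, 0, 0, 0, 0, 0, 0, 0, 1]), (7, []), (7, []), (7, [])],
      [(5, [0, 6, 2, 1, 0, 0, 0, 0, 0, 0, 0, 1, 2, 6]), (5, []), (5, []), (5, []), (5, []),
        (5, []), (5, [])],
      [(5, [0, 5, 2, 1, 0, 0, 0, 0, 0, 0, 0, 1, 2, 5]), (5, []), (5, []), (5, []), (5, []),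
        (5, []), (5, []), (5, [])],
      [(4, [0, 38, 24, 14, 6, 2, 0, 0, 1, 2, 2, 1]), (4, []), (4, []), (4, []), (4, []), (4,
        []), (4, []), (4, []), (4, [])],
      [(3, [0, 9, 6, 4, 2, 1, 0, 0, 0, 1, 2, 4, 6, 9]), (3, []), (3, []), (3, []), (3, []),
        (3, []), (3, []), (3, []), (3, []), (3, [])],
      [(3, [0, 8, 5, 4, 2, 1, 0, 0, 0, 1, 2, 4, 5, 8]), (3, []), (3, []), (3, []), (3, []),
        (3, []), (3, []), (3, []), (3, []), (3, []), (3, [])],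
      [(3, [0, 8, 5, 4, 2, 1, 0, 0, 0, 1, 2, 4, 5, 8]), (3, []), (3, []), (3, []), (3, []),
        (3, []), (3, []), (3, []), (3, []), (3, []), (3, []), (3, [])],
      [(2, [0, 18, 17, 16, 14, 12, 10, 8, 6, 4, 2, 1]), (2, []), (2, []), (2, []), (2, []),
        (2, []), (2, []), (2, []), (2, []), (2, []), (2, []), (2, []), (2, [])],
      [(2, [0, 13, 11, 9, 7, 5, 3, 1, -1, -3, -5, -7, -9, -11]), (2, [0, 0, 0, 0, 0, 0, 0,
        0, -2, -6, -10, -14, -18, -22]), (3, [0, 59, 39, 24, 12, 4, 0, 0, 0, 0, 4, 12, 24,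
        39]), (3, []), (3, []), (3, []), (3, []), (3, []), (3, []), (3, []), (3, [])],
      [(2, [0, 9, 8, 7, 6, 5, 4, 3, 2, 1, 0, -1, -2, -3]), (2, [0, 0, 0, 0, 0, 0, 0, 0, 0,
        0, 0, -2, -4, -6]), (2, [0, 0, 0, 0, 0, 0, 0, 0, 0, 0, 0, -4, -8, -12]), (2, [0, 0,
        0, 0, 0, 0, 0, 0, 0, 0, 0, -8, -15, -23]), (2, [0, 0, 0, 0, 0, 0, 0, 0, 0, 0, 0,
        -15, -31, -46]), (2, [0, 0, 0, 0, 0, 0, 0, 0, 0, 0, 0, -31, -62, -92]), (5, [0, 369,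
        123, 62, 0, 0, 0, 0, 0, 0, 0, 0, 0, 185]), (5, []), (5, []), (5, []), (5, []), (5,
        [])],
      [(7, [0, 1, 0, 0, 0, 0, 0, 0, 0, 0, 0, 0, 0, 1]), (7, []), (9, [])],
      [(8, [0, 1, 0, 0, 0, 0, 0, 0, 0, 0, 0, 0, 0, -1]), (11, [])]]
  | 14 => [
      [(10, [0, 1]), (10, [])],
      [(9, [0, 1, 0, 0, 0, 0, 0, 0, 0, 0, 0, 0, 0, 0, 1]), (9, []), (9, [])],
      [(8, [0, 1]), (8, []), (8, []), (8, [])],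
      [(7, [0, 1, 0, 0, 0, 0, 0, 0, 0, 0, 0, 0, 0, 0, 1]), (7, []), (7, []), (7, []), (7,
        [])],
      [(5, [0, 6, 2, 1, 0, 0, 0, 0, 0, 0, 0, 1, 2, 6, 9]), (5, []), (5, []), (5, []), (5,
        []), (5, []), (5, []), (5, [])],
      [(5, [0, 5, 1, 1, 0, 0, 0, 0, 0, 0, 0, 0, 1, 1, 5]), (5, []), (5, []), (5, []), (5,
        []), (5, []), (5, []), (5, []), (5, [])],
      [(4, [0, 27, 18, 11, 5, 2, 0, 0, 0, 1, 1, 1]), (4, []), (4, []), (4, []), (4, []), (4,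
        []), (4, []), (4, []), (4, []), (4, [])],
      [(3, [0, 20, 15, 10, 6, 3, 1, 0, 0, 1, 3, 6, 10, 15, 20]), (3, []), (3, []), (3, []),
        (3, []), (3, []), (3, []), (3, []), (3, []), (3, []), (3, [])],
      [(3, [0, 19, 13, 9, 5, 3, 1, 0, 0, 1, 3, 5, 9, 13, 19]), (3, []), (3, []), (3, []),
        (3, []), (3, []), (3, []), (3, []), (3, []), (3, []), (3, []), (3, [])],
      [(3, [0, 24, 15, 12, 6, 4, 1, 0, 0, 0, 3, 4, 10, 12, 21]), (3, []), (3, []), (3, []),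
        (3, []), (3, []), (3, []), (3, []), (3, []), (3, []), (3, []), (3, []), (3, [])],
      [(2, [0, 10, 9, 9, 8, 7, 6, 5, 4, 3, 2, 1]), (2, []), (2, []), (2, []), (2, []), (2,
        []), (2, []), (2, []), (2, []), (2, []), (2, []), (2, []), (2, []), (2, [])],
      [(2, [0, 7, 6, 5, 4, 3, 2, 1, 0, -1, -2, -3, -4, -5, -6]), (2, [0, 0, 0, 0, 0, 0, 0,
        0, 0, -2, -4, -6, -8, -10, -12]), (3, [0, 36, 24, 16, 8, 4, 0, 0, 0, 0, 0, 4, 8, 16,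
        24]), (3, []), (3, []), (3, []), (3, []), (3, []), (3, []), (3, []), (3, []), (3,
        [])],
      [(2, [0, 18, 16, 14, 12, 10, 8, 6, 4, 2, 0, -2, -4, -6, -8]), (2, [0, 0, 0, 0, 0, 0,
        0, 0, 0, 0, 0, -4, -8, -12, -16]), (2, [0, 0, 0, 0, 0, 0, 0, 0, 0, 0, 0, -8, -16,
        -24, -32]), (2, [0, 0, 0, 0, 0, 0, 0, 0, 0, 0, 0, -16, -32, -48, -64]), (2, [0, 0,
        0, 0, 0, 0, 0, 0, 0, 0, 0, -32, -64, -97, -129]), (2, [0, 0, 0, 0, 0, 0, 0, 0, 0, 0,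
        0, -64, -129, -193, -258]), (5, [0, 773, 258, 129, 0, 0, 0, 0, 0, 0, 0, 0, 0, 387,
        773]), (5, []), (5, []), (5, []), (5, []), (5, []), (5, [])],
      [(4, [0, 306, 188, 110, 50, 20, 0, 0, 0, 11, 13, 16, 0, -24, -75]), (4, [0, 0, 0, 0,
        0, 0, 0, 0, 0, 0, 0, 0, 0, -47, -151]), (4, [0, 0, 0, 0, 0, 0, 0, 0, 0, 0, 0, 0, 0,
        -94, -301]), (4, [0, 0, 0, 0, 0, 0, 0, 0, 0, 0, 0, 0, 0, -188, -602]), (4, [0, 0, 0,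
        0, 0, 0, 0, 0, 0, 0, 0, 0, 0, -377, -1205]), (4, [0, 0, 0, 0, 0, 0, 0, 0, 0, 0, 0,
        0, 0, -753, -2410]), (7, [0, 1807, 0, 0, 0, 0, 0, 0, 0, 0, 0, 0, 0, 0, -1506]), (7,
        [0, 0, 0, 0, 0, 0, 0, 0, 0, 0, 0, 0, 0, 0, -3012]), (9, [])],
      [(9, [0, 1, 0, 0, 0, 0, 0, 0, 0, 0, 0, 0, 0, 0, 1]), (11, [])],
      [(7, [0, 1, 0, 0, 0, 0, 0, 0, 0, 0, 0, 0, 0, 0, 1]), (7, []), (7, []), (9, [])],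
      [(4, [0, 176, 107, 62, 28, 11, 0, 0, 0, 5, 4, 2, -12, -34, -73]), (4, [0, 0, 0, 0, 0,
        0, 0, 0, 0, 0, 0, 0, -25, -67, -146]), (4, [0, 0, 0, 0, 0, 0, 0, 0, 0, 0, 0, 0, -50,
        -135, -291]), (5, [0, 328, 99, 57, 0, 0, 0, 0, 0, 0, 0, 42, 0, 0, -85]), (5, [0, 0,
        0, 0, 0, 0, 0, 0, 0, 0, 0, 0, 0, 0, -170]), (5, [0, 0, 0, 0, 0, 0, 0, 0, 0, 0, 0, 0,
        0, 0, -339]), (5, [0, 0, 0, 0, 0, 0, 0, 0, 0, 0, 0, 0, 0, 0, -678]), (5, [0, 0, 0,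
        0, 0, 0, 0, 0, 0, 0, 0, 0, 0, 0, -1356]), (11, [])],
      [(8, [0, 1]), (8, [0, 0, 0, 0, 0, 0, 0, 0, 0, 0, 0, 0, 0, 0, -1]), (9, [])],
      [(5, [0, 5, 2, 1, 0, 0, 0, 0, 0, 0, 0, 0, 0, 1, 5]), (6, [0, 18, 5, 0, 0, 0, 0, 0, 0,
        0, 0, 0, 0, -3, -27]), (7, [0, 18]), (7, []), (7, []), (7, [])],
      [(7, [0, 1, 0, 0, 0, 0, 0, 0, 0, 0, 0, 0, 0, 0, 1]), (7, []), (13, [])]]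
  | _ => []

/-- Patterns of minimum distances in chains of codes of length `n` that are excluded by the
nonexistence of a binary linear code of length 13, dimension 5 and minimum distance 6. -/
def griesmerPatterns : ℕ → List (List ℕ)
  | 13 => [[6, 6, 6, 6, 6]]
  | 14 => [[6, 6, 6, 6, 6, 6]]
  | _ => []

/-- All the excluded patterns of minimum distances in chains of codes of length `n`. -/
def excludedPatterns (n : ℕ) : List (List ℕ) :=
  griesmerPatterns n ++ (dualCertificates n).map fun q => (q.map Prod.fst).reverse

lemma dualCertificates_valid : ∀ n ∈ List.range 15, ∀ q ∈ dualCertificates n,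
    q.length ≤ n ∧ dualBound n [] q < 0 := by
  decide +kernel

lemma distanceBounds_valid : ∀ n ∈ List.range 15, ∀ k < (distanceBounds n).length,
    n ≤ (distanceBounds n).getD k 0 ∨ ∃ l ∈ excludedPatterns n,
      l.length ≤ k + 1 ∧ ∀ p ∈ l, p ≤ (distanceBounds n).getD k 0 + 1 := by
  decide +kernel

lemma productSearch_valid : ∀ n ∈ List.range 15, 2 ≤ n →
    productSearch (n ^ n) (distanceBounds n) n 1 (excludedPatterns n) = true := by
  decide +kernel

lemma length_distanceBounds : ∀ n ∈ List.range 15, 2 ≤ n → (distanceBounds n).length = n := by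
  decide +kernel

/-- An antitone sequence avoiding all the excluded patterns has a small product. -/
lemma sq_prod_le_of_not_dominatesFrom {n : ℕ} (h2 : 2 ≤ n) (h14 : n ≤ 14) {d : ℕ → ℕ}
    (hpos : ∀ k < n, 1 ≤ d k) (hle : ∀ k < n, d k ≤ n)
    (hanti : ∀ j k, j ≤ k → k < n → d k ≤ d j)
    (hd : ∀ l ∈ excludedPatterns n, ¬ DominatesFrom d 0 l) :
    (∏ k ∈ Finset.range n, d k) ^ 2 ≤ n ^ n := by
  have hn : n ∈ List.range 15 := List.mem_range.2 (by omega)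
  have hlen := length_distanceBounds n hn h2
  have hbound : ∀ k < n, d k ≤ (distanceBounds n).getD k 0 := by
    intro k hk
    rcases distanceBounds_valid n hn k (by omega) with h | ⟨l, hl, hlk, hlp⟩
    · exact (hle k hk).trans h
    · by_contra! hlt
      refine hd l hl (dominatesFrom_of_forall_le l 0 fun p hp j hj => ?_)
      have h1 := hlp p hp
      have h2 := hanti j k (by omega) hk
      rw [zero_add]
      omega
  have := sq_prod_le_of_productSearch (d := d) (distanceBounds n) 0 n 1 (excludedPatterns n)
    (fun j hj => by
      rw [hlen] at hj
      rw [zero_add]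
      exact ⟨hpos j hj, hle j hj, hbound j hj⟩)
    (fun j k hjk hk => by simpa using hanti j k hjk (by omega)) hd (productSearch_valid n hn h2)
  simpa [hlen] using this

section Plotkin

variable {ι : Type*} {W : Finset (ι → ZMod 2)}

lemma word_add_self (c : ι → ZMod 2) : c + c = 0 := funext fun _ => CharTwo.add_self_eq_zero _

lemma filter_filter_eq_zero_self (W : Finset (ι → ZMod 2)) (i : ι) :
    ((W.filter fun c => c i = 0).filter fun c => c i = 0) = W.filter fun c => c i = 0 := by
  simp [Finset.filter_filter]

/-- A set of binary words closed under addition. -/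
def IsAddClosed (W : Finset (ι → ZMod 2)) : Prop := ∀ a ∈ W, ∀ b ∈ W, a + b ∈ W

lemma IsAddClosed.filter (hW : IsAddClosed W) (i : ι) :
    IsAddClosed (W.filter fun c => c i = 0) := by
  intro a ha b hb
  rw [Finset.mem_filter] at ha hb ⊢
  exact ⟨hW a ha.1 b hb.1, by simp [ha.2, hb.2]⟩

lemma IsAddClosed.two_mul_card_filter (hW : IsAddClosed W) {i : ι} {a : ι → ZMod 2} (ha : a ∈ W)
    (hai : a i ≠ 0) : 2 * (W.filter fun c => c i = 0).card = W.card := by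
  have key : ∀ x y : ZMod 2, x ≠ 0 → (x + y = 0 ↔ y ≠ 0) := by decide
  have hcard : (W.filter fun c => c i = 0).card = (W.filter fun c => ¬ c i = 0).card := by
    refine Finset.card_nbij' (a + ·) (a + ·) ?_ ?_ ?_ ?_
    · intro c hc
      simp only [Finset.coe_filter, Set.mem_ofPred_eq] at hc ⊢
      refine ⟨hW a ha c hc.1, ?_⟩
      rw [Pi.add_apply, key _ _ hai]
      simp [hc.2]
    · intro c hc
      simp only [Finset.coe_filter, Set.mem_ofPred_eq] at hc ⊢
      exact ⟨hW a ha c hc.1, by rw [Pi.add_apply, key _ _ hai]; exact hc.2⟩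
    · intro c _
      simp [← add_assoc, word_add_self]
    · intro c _
      simp [← add_assoc, word_add_self]
  have := Finset.card_filter_add_card_filter_not (s := W) (fun c => c i = 0)
  omega

lemma IsAddClosed.card_filter (hW : IsAddClosed W) (i : ι) :
    (W.filter fun c => c i = 0).card = W.card ∨ 2 * (W.filter fun c => c i = 0).card = W.card := by
  by_cases h : ∃ a ∈ W, a i ≠ 0
  · obtain ⟨a, ha, hai⟩ := h
    exact Or.inr (hW.two_mul_card_filter ha hai)
  · push Not at h
    exact Or.inl (by rw [Finset.filter_true_of_mem h])

/-- The Plotkin bound. -/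
lemma IsAddClosed.two_mul_mul_card_le [Fintype ι] {S : Finset ι} (hW : IsAddClosed W)
    (hS : ∀ c ∈ W, ∀ i ∉ S, c i = 0) {w : ℕ}
    (hw : ∀ c ∈ W, c ≠ 0 → w ≤ hammingNorm c) :
    2 * w * W.card ≤ S.card * W.card + 2 * w := by
  have hsum : ∑ c ∈ W, hammingNorm c = ∑ i ∈ S, (W.filter fun c => ¬ c i = 0).card := by
    simp only [Finset.card_filter]
    rw [Finset.sum_comm]
    refine Finset.sum_congr rfl fun c hc => ?_
    rw [hammingNorm, Finset.card_filter]
    refine (Finset.sum_subset (Finset.subset_univ S) fun i _ hi => ?_).symm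
    simp [hS c hc i hi]
  have hupper : 2 * ∑ i ∈ S, (W.filter fun c => ¬ c i = 0).card ≤ S.card * W.card := by
    rw [Finset.mul_sum, ← smul_eq_mul, ← Finset.sum_const]
    refine Finset.sum_le_sum fun i _ => ?_
    have := Finset.card_filter_add_card_filter_not (s := W) (fun c => c i = 0)
    have := hW.card_filter i
    omega
  have hlower : w * W.card ≤ ∑ c ∈ W, hammingNorm c + w := by
    by_cases h0 : (0 : ι → ZMod 2) ∈ W
    · rw [← Finset.sum_erase_add _ _ h0, ← Finset.card_erase_add_one h0, hammingNorm_zero,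
        add_zero, mul_add, mul_one, mul_comm, ← smul_eq_mul, ← Finset.sum_const]
      refine Nat.add_le_add_right (Finset.sum_le_sum fun c hc => ?_) w
      exact hw c (Finset.mem_of_mem_erase hc) (Finset.ne_of_mem_erase hc)
    · rw [mul_comm, ← smul_eq_mul, ← Finset.sum_const]
      refine le_add_right (Finset.sum_le_sum fun c hc => hw c hc fun h => h0 (h ▸ hc))
  rw [mul_assoc]
  omega

end Plotkin

section ShortCode

variable {ι : Type*} {W : Finset (ι → ZMod 2)} {S : Finset ι}

/-- The number of places of `S` at which a word vanishes. -/
def zeroCount (S : Finset ι) (c : ι → ZMod 2) : ℕ := (S.filter fun i => c i = 0).card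

lemma zeroCount_add_hammingNorm [Fintype ι] {c : ι → ZMod 2} (hS : ∀ i ∉ S, c i = 0) :
    zeroCount S c + hammingNorm c = S.card := by
  rw [← Finset.card_filter_add_card_filter_not (s := S) (fun i => c i = 0), zeroCount, hammingNorm]
  congr 2
  ext i
  simp only [Finset.mem_filter, Finset.mem_univ, true_and, ne_eq]
  exact ⟨fun h => ⟨by_contra fun hi => h (hS i hi), h⟩, fun h => h.2⟩

lemma sum_zeroCount_mul (W : Finset (ι → ZMod 2)) (S : Finset ι) (f : (ι → ZMod 2) → ℕ) :
    ∑ c ∈ W, zeroCount S c * f c = ∑ i ∈ S, ∑ c ∈ W.filter fun c => c i = 0, f c := by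
  simp only [zeroCount, Finset.card_filter, Finset.sum_mul, Finset.sum_filter]
  rw [Finset.sum_comm]
  simp

/-- The power moments of the numbers of zeros of the words of a code in which the numbers of words
vanishing at one, two or three given places do not depend on the places. -/
lemma sum_zeroCount_pow [DecidableEq ι] {m : ℕ}
    (h : ∀ i ∈ S, ∀ j ∈ S, ∀ k ∈ S,
      (((W.filter fun c => c i = 0).filter fun c => c j = 0).filter fun c => c k = 0).card =
        m + (if j = i then m else 0) + (if k = i then m else 0) + if k = j then m else 0) :
    ∑ c ∈ W, zeroCount S c = S.card * (4 * m) ∧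
    ∑ c ∈ W, zeroCount S c ^ 2 = S.card * (2 * m * (S.card + 1)) ∧
    ∑ c ∈ W, zeroCount S c ^ 3 = S.card * (S.card * (m * (S.card + 3))) := by
  have h2 : ∀ i ∈ S, ∀ j ∈ S, ((W.filter fun c => c i = 0).filter fun c => c j = 0).card =
      2 * m + if j = i then 2 * m else 0 := by
    intro i hi j hj
    have := h i hi j hj j hj
    rw [filter_filter_eq_zero_self, if_pos rfl] at this
    rw [this]
    split_ifs <;> ring
  have h1 : ∀ i ∈ S, (W.filter fun c => c i = 0).card = 4 * m := by
    intro i hi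
    have := h2 i hi i hi
    rw [filter_filter_eq_zero_self, if_pos rfl] at this
    rw [this]
    ring
  refine ⟨?_, ?_, ?_⟩
  · have := sum_zeroCount_mul W S fun _ => 1
    simp only [mul_one, Finset.sum_const, smul_eq_mul] at this
    rw [this, Finset.sum_congr rfl h1, Finset.sum_const, smul_eq_mul]
  · simp only [pow_two, sum_zeroCount_mul]
    rw [← smul_eq_mul S.card, ← Finset.sum_const]
    refine Finset.sum_congr rfl fun i hi => ?_
    have := sum_zeroCount_mul (W.filter fun c => c i = 0) S fun _ => 1
    simp only [mul_one, Finset.sum_const, smul_eq_mul] at this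
    rw [this, Finset.sum_congr rfl (h2 i hi), Finset.sum_add_distrib, Finset.sum_const,
      Finset.sum_ite_eq' S i, if_pos hi, smul_eq_mul]
    ring
  · simp only [pow_succ, pow_zero, one_mul, mul_assoc, sum_zeroCount_mul]
    rw [← smul_eq_mul S.card, ← Finset.sum_const]
    refine Finset.sum_congr rfl fun i hi => ?_
    have h3 : ∀ j ∈ S, ∑ c ∈ (W.filter fun c => c i = 0).filter fun c => c j = 0, zeroCount S c =
        m * S.card + (if j = i then m * S.card else 0) + 2 * m := by
      intro j hj
      have := sum_zeroCount_mul ((W.filter fun c => c i = 0).filter fun c => c j = 0) S fun _ => 1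
      simp only [mul_one, Finset.sum_const, smul_eq_mul] at this
      rw [this, Finset.sum_congr rfl (h i hi j hj), Finset.sum_add_distrib,
        Finset.sum_add_distrib, Finset.sum_const, Finset.sum_ite_eq' S i, Finset.sum_ite_eq' S j,
        if_pos hi, if_pos hj, smul_eq_mul]
      split_ifs <;> ring
    rw [Finset.sum_congr rfl h3, Finset.sum_add_distrib, Finset.sum_add_distrib,
      Finset.sum_ite_eq' S i, if_pos hi]
    simp only [Finset.sum_const, smul_eq_mul]
    ring

lemma power_moments_inconsistent {n₀ n₁ n₂ n₃ n₄ n₅ n₆ n₇ : ℕ} (hfew : n₀ + n₁ + n₂ ≤ 1)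
    (h0 : n₀ + n₁ + n₂ + n₃ + n₄ + n₅ + n₆ + n₇ = 31)
    (h1 : n₁ + n₂ * 2 + n₃ * 3 + n₄ * 4 + n₅ * 5 + n₆ * 6 + n₇ * 7 = 195)
    (h2 : n₁ + n₂ * 4 + n₃ * 9 + n₄ * 16 + n₅ * 25 + n₆ * 36 + n₇ * 49 = 1287)
    (h3 : n₁ + n₂ * 8 + n₃ * 27 + n₄ * 64 + n₅ * 125 + n₆ * 216 + n₇ * 343 = 8619) : False := by
  have e1 : n₆ + 2 * n₅ + 3 * n₄ + 4 * n₃ + 5 * n₂ + 6 * n₁ + 7 * n₀ = 22 := by omega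
  have e2 : n₆ + 4 * n₅ + 9 * n₄ + 16 * n₃ + 25 * n₂ + 36 * n₁ + 49 * n₀ = 76 := by omega
  have e3 : n₆ + 8 * n₅ + 27 * n₄ + 64 * n₃ + 125 * n₂ + 216 * n₁ + 343 * n₀ = 376 := by omega
  clear h0 h1 h2 h3
  have : n₀ ≤ 1 := by omega
  have : n₁ ≤ 1 := by omega
  have : n₂ ≤ 1 := by omega
  interval_cases n₀ <;> interval_cases n₁ <;> interval_cases n₂ <;> omega

/-- There is no binary linear code of length 13, dimension 5 and minimum distance 6. -/
lemma IsAddClosed.exists_hammingNorm_lt_six [Fintype ι] [DecidableEq ι] (hW : IsAddClosed W)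
    (hcard : W.card = 32) (hScard : S.card = 13) (hS : ∀ c ∈ W, ∀ i ∉ S, c i = 0) :
    ∃ c ∈ W, c ≠ 0 ∧ hammingNorm c < 6 := by
  by_contra! hmin
  have h2 : ∀ i ∈ S, ∀ j ∈ S, j ≠ i →
      ((W.filter fun c => c i = 0).filter fun c => c j = 0).card ≤ 12 := by
    intro i hi j hj hji
    have := ((hW.filter i).filter j).two_mul_mul_card_le (S := (S.erase i).erase j) (w := 6)
      (fun c hc k hk => by
        simp only [Finset.mem_filter, Finset.mem_erase] at hc hk
        by_contra h0
        refine h0 (hS c hc.1.1 k fun hkS => hk ⟨?_, ?_, hkS⟩)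
        · rintro rfl; exact h0 hc.2
        · rintro rfl; exact h0 hc.1.2)
      (fun c hc => hmin c (by simp only [Finset.mem_filter] at hc; exact hc.1.1))
    rw [Finset.card_erase_of_mem (Finset.mem_erase.2 ⟨hji, hj⟩), Finset.card_erase_of_mem hi,
      hScard] at this
    omega
  have h3 : ∀ i ∈ S, ∀ j ∈ S, ∀ k ∈ S, j ≠ i → k ≠ i → k ≠ j →
      (((W.filter fun c => c i = 0).filter fun c => c j = 0).filter fun c => c k = 0).card ≤ 6 := by
    intro i hi j hj k hk hji hki hkj
    have := (((hW.filter i).filter j).filter k).two_mul_mul_card_le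
      (S := ((S.erase i).erase j).erase k) (w := 6)
      (fun c hc l hl => by
        simp only [Finset.mem_filter, Finset.mem_erase] at hc hl
        by_contra h0
        refine h0 (hS c hc.1.1.1 l fun hlS => hl ⟨?_, ?_, ?_, hlS⟩)
        · rintro rfl; exact h0 hc.2
        · rintro rfl; exact h0 hc.1.2
        · rintro rfl; exact h0 hc.1.1.2)
      (fun c hc => hmin c (by simp only [Finset.mem_filter] at hc; exact hc.1.1.1))
    rw [Finset.card_erase_of_mem (Finset.mem_erase.2 ⟨hkj, Finset.mem_erase.2 ⟨hki, hk⟩⟩),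
      Finset.card_erase_of_mem (Finset.mem_erase.2 ⟨hji, hj⟩), Finset.card_erase_of_mem hi,
      hScard] at this
    omega
  have hone : ∀ i ∈ S, (W.filter fun c => c i = 0).card = 16 := by
    intro i hi
    obtain ⟨j, hj, hji⟩ := Finset.exists_mem_ne (by omega : 1 < S.card) i
    have := h2 i hi j hj hji
    have := hW.card_filter i
    have := (hW.filter i).card_filter j
    omega
  have htwo : ∀ i ∈ S, ∀ j ∈ S, j ≠ i →
      ((W.filter fun c => c i = 0).filter fun c => c j = 0).card = 8 := by
    intro i hi j hj hji
    have := h2 i hi j hj hji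
    have := hone i hi
    have := (hW.filter i).card_filter j
    omega
  obtain ⟨hm1, hm2, hm3⟩ := sum_zeroCount_pow (W := W) (S := S) (m := 4) (by
    intro i hi j hj k hk
    by_cases hji : j = i
    · subst hji
      rw [filter_filter_eq_zero_self]
      by_cases hkj : k = j
      · subst hkj
        rw [filter_filter_eq_zero_self]
        simp [hone k hk]
      · simp [hkj, htwo j hj k hk hkj]
    · by_cases hki : k = i
      · subst hki
        rw [Finset.filter_comm, filter_filter_eq_zero_self]
        simp [hji, Ne.symm hji, htwo k hk j hj hji]
      · by_cases hkj : k = j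
        · subst hkj
          rw [filter_filter_eq_zero_self]
          simp [hji, htwo i hi k hk hji]
        · have := h3 i hi j hj k hk hji hki hkj
          have := htwo i hi j hj hji
          have := ((hW.filter i).filter j).card_filter k
          simp only [hji, hki, hkj, if_false]
          omega)
  have h0 : (0 : ι → ZMod 2) ∈ W := by
    obtain ⟨c, hc⟩ := Finset.card_pos.1 (by omega : 0 < W.card)
    exact word_add_self c ▸ hW c hc c hc
  have hz : ∀ c ∈ W, zeroCount S c + hammingNorm c = 13 := fun c hc =>
    hScard ▸ zeroCount_add_hammingNorm (hS c hc)
  have hz0 : zeroCount S (0 : ι → ZMod 2) = 13 := by simpa using hz 0 h0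
  have hmaps : ∀ c ∈ W.erase 0, zeroCount S c ∈ Finset.range 8 := by
    intro c hc
    have := hmin c (Finset.mem_of_mem_erase hc) (Finset.ne_of_mem_erase hc)
    have := hz c (Finset.mem_of_mem_erase hc)
    rw [Finset.mem_range]
    omega
  have hfiber : ∀ f : ℕ → ℕ, ∑ c ∈ W.erase 0, f (zeroCount S c) = ∑ v ∈ Finset.range 8,
      ((W.erase 0).filter fun c => zeroCount S c = v).card * f v := by
    intro f
    rw [← Finset.sum_fiberwise_of_maps_to' hmaps]
    simp
  have hfew : ((W.erase 0).filter fun c => zeroCount S c ≤ 2).card ≤ 1 := by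
    rw [Finset.card_le_one]
    intro a ha b hb
    simp only [Finset.mem_filter, Finset.mem_erase] at ha hb
    by_contra hab
    have hne : a + b ≠ 0 := fun h => hab (by
      rw [← add_zero a, ← word_add_self b, ← add_assoc, h, zero_add])
    have hle : hammingNorm (a + b) ≤ zeroCount S a + zeroCount S b := by
      refine le_trans (Finset.card_le_card fun i hi => ?_) (Finset.card_union_le _ _)
      have key : ∀ x y : ZMod 2, x + y ≠ 0 → x = 0 ∨ y = 0 := by decide
      have hi : a i + b i ≠ 0 := by simpa using hi
      have hiS : i ∈ S := by_contra fun hiS =>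
        hi (by rw [hS a ha.1.2 i hiS, hS b hb.1.2 i hiS]; rfl)
      simpa [hiS] using key _ _ hi
    have := hmin (a + b) (hW a ha.1.2 b hb.1.2) hne
    omega
  have s0 := hfiber fun _ => 1
  have s1 := hfiber fun v => v
  have s2 := hfiber fun v => v ^ 2
  have s3 := hfiber fun v => v ^ 3
  have s4 := hfiber fun v => if v ≤ 2 then 1 else 0
  rw [← Finset.sum_erase_add _ _ h0, hz0, hScard] at hm1 hm2 hm3
  rw [← Finset.card_filter] at s4
  rw [← Finset.card_eq_sum_ones, Finset.card_erase_of_mem h0, hcard] at s0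
  simp only [Finset.sum_range_succ, Finset.sum_range_zero] at s0 s1 s2 s3 s4
  norm_num at s0 s1 s2 s3 s4
  rw [s1] at hm1
  rw [s2] at hm2
  rw [s3] at hm3
  rw [s4] at hfew
  exact power_moments_inconsistent hfew s0.symm (by omega) (by omega) (by omega)

end ShortCode

section DistanceChain

variable {ι : Type*}

lemma zero_mem_words : ∀ bs : List (ι → ZMod 2), 0 ∈ words bs
  | [] => List.mem_singleton_self 0
  | _ :: bs => List.mem_append_left _ (zero_mem_words bs)

lemma add_mem_words : ∀ {bs : List (ι → ZMod 2)} {x y : ι → ZMod 2},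
    x ∈ words bs → y ∈ words bs → x + y ∈ words bs
  | [], x, y, hx, hy => by
    rw [words, List.mem_singleton] at hx hy
    simp [hx, hy, words]
  | b :: bs, x, y, hx, hy => by
    rw [words, List.mem_append, List.mem_map] at hx hy ⊢
    rcases hx with hx | ⟨x, hx, rfl⟩ <;> rcases hy with hy | ⟨y, hy, rfl⟩
    · exact Or.inl (add_mem_words hx hy)
    · exact Or.inr ⟨x + y, add_mem_words hx hy, add_left_comm _ _ _⟩
    · exact Or.inr ⟨x + y, add_mem_words hx hy, (add_assoc _ _ _).symm⟩
    · rw [add_add_add_comm, word_add_self, zero_add]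
      exact Or.inl (add_mem_words hx hy)

lemma exists_sum_eq_of_mem_words {b : ℕ → ι → ZMod 2} : ∀ {k : ℕ} {c : ι → ZMod 2},
    c ∈ words (firstRows b k) → ∃ T ⊆ Finset.range k, ∑ i ∈ T, b i = c
  | 0, c, hc => ⟨∅, Finset.empty_subset _, by
      rw [firstRows, words, List.mem_singleton] at hc
      simp [hc]⟩
  | k + 1, c, hc => by
    rw [firstRows, words, List.mem_append, List.mem_map] at hc
    rcases hc with hc | ⟨c, hc, rfl⟩
    · obtain ⟨T, hT, rfl⟩ := exists_sum_eq_of_mem_words hc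
      exact ⟨T, hT.trans (Finset.range_subset_range.2 k.le_succ), rfl⟩
    · obtain ⟨T, hT, rfl⟩ := exists_sum_eq_of_mem_words hc
      have hk : k ∉ T := fun h => Finset.notMem_range_self (hT h)
      exact ⟨insert k T, by rw [Finset.range_add_one]; exact Finset.insert_subset_insert k hT,
        Finset.sum_insert hk⟩

variable {n : ℕ} {b : ℕ → Fin n → ZMod 2} {d : ℕ → ℕ} {k w : ℕ}

lemma IsDistanceChain.le_hammingNorm (hb : IsDistanceChain b d) : ∀ {k : ℕ}, k ≤ n →
    (∀ j < k, w ≤ d j) → ∀ c ∈ words (firstRows b k), c ≠ 0 → w ≤ hammingNorm c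
  | 0, _, _, c, hc, h0 => by
    rw [firstRows, words, List.mem_singleton] at hc
    exact absurd hc h0
  | k + 1, hk, hw, c, hc, h0 => by
    rw [firstRows, words, List.mem_append, List.mem_map] at hc
    rcases hc with hc | ⟨c, hc, rfl⟩
    · exact hb.le_hammingNorm (by omega) (fun j hj => hw j (by omega)) c hc h0
    · exact (hw k k.lt_succ_self).trans (hb k hk c hc)

lemma IsDistanceChain.nodup_words (hb : IsDistanceChain b d) : ∀ {k : ℕ}, k ≤ n →
    (∀ j < k, 1 ≤ d j) → (words (firstRows b k)).Nodup
  | 0, _, _ => List.nodup_singleton _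
  | k + 1, hk, hd => by
    have ih := hb.nodup_words (k := k) (by omega) fun j hj => hd j (by omega)
    rw [firstRows, words, List.nodup_append]
    refine ⟨ih, ih.map (add_right_injective _), fun x hx y hy hxy => ?_⟩
    obtain ⟨c, hc, rfl⟩ := List.mem_map.1 hy
    have h1 := hb k hk _ (add_mem_words hc hx)
    have h2 := hd k k.lt_succ_self
    rw [← add_assoc, ← hxy, word_add_self, hammingNorm_zero] at h1
    omega

/-- The code spanned by the first `k` words of a chain whose distances are at least `w`. -/
lemma IsDistanceChain.exists_isAddClosed (hb : IsDistanceChain b d) (hk : k ≤ n) (hw : 1 ≤ w)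
    (hd : ∀ j < k, w ≤ d j) : ∃ W : Finset (Fin n → ZMod 2),
      IsAddClosed W ∧ W.card = 2 ^ k ∧ ∀ c ∈ W, c ≠ 0 → w ≤ hammingNorm c := by
  refine ⟨(words (firstRows b k)).toFinset, ?_, ?_, ?_⟩
  · intro x hx y hy
    rw [List.mem_toFinset] at hx hy ⊢
    exact add_mem_words hx hy
  · rw [List.toFinset_card_of_nodup (hb.nodup_words hk fun j hj => hw.trans (hd j hj)),
      length_words, length_firstRows]
  · intro c hc
    exact hb.le_hammingNorm hk hd c (List.mem_toFinset.1 hc)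

lemma dominatesFrom_replicate {d : ℕ → ℕ} {w : ℕ} : ∀ {k i : ℕ},
    DominatesFrom d i (List.replicate k w) → ∀ j < k, w ≤ d (i + j)
  | k + 1, i, h, 0, _ => h.1
  | k + 1, i, h, j + 1, hj => by
    have := dominatesFrom_replicate h.2 j (by omega)
    rwa [add_assoc, add_comm 1] at this

lemma IsDistanceChain.not_dominatesFrom_griesmerPatterns (hb : IsDistanceChain b d) {l : List ℕ}
    (hl : l ∈ griesmerPatterns n) : ¬ DominatesFrom d 0 l := by
  intro h
  unfold griesmerPatterns at hl
  split at hl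
  · rw [List.mem_singleton] at hl
    rw [hl] at h
    obtain ⟨W, hW, hcard, hmin⟩ := hb.exists_isAddClosed (k := 5) (w := 6) (by simp) (by simp)
      fun j hj => by simpa using dominatesFrom_replicate (k := 5) h j hj
    obtain ⟨c, hc, h0, hlt⟩ := hW.exists_hammingNorm_lt_six (S := Finset.univ) hcard (by simp)
      (by simp)
    exact hlt.not_ge (hmin c hc h0)
  · rw [List.mem_singleton] at hl
    rw [hl] at h
    obtain ⟨W, hW, hcard, hmin⟩ := hb.exists_isAddClosed (k := 6) (w := 6) (by simp) (by simp)
      fun j hj => by simpa using dominatesFrom_replicate (k := 6) h j hj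
    obtain ⟨a, ha, ha0⟩ := Finset.exists_mem_ne (by rw [hcard]; norm_num : 1 < W.card) 0
    obtain ⟨i, hi⟩ := Function.ne_iff.1 ha0
    have hhalf := hW.two_mul_card_filter ha hi
    obtain ⟨c, hc, h0, hlt⟩ := (hW.filter i).exists_hammingNorm_lt_six
      (S := Finset.univ.erase i) (by omega) (by simp) (fun c hc j hj => by
        have : j = i := by simpa using hj
        exact this ▸ (Finset.mem_filter.1 hc).2)
    exact hlt.not_ge (hmin c (Finset.mem_filter.1 hc).1 h0)
  · simp at hl

lemma IsDistanceChain.not_dominatesFrom (hb : IsDistanceChain b d) (hn : n ≤ 14) {l : List ℕ}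
    (hl : l ∈ excludedPatterns n) : ¬ DominatesFrom d 0 l := by
  rcases List.mem_append.1 hl with hl | hl
  · exact hb.not_dominatesFrom_griesmerPatterns hl
  · obtain ⟨q, hq, rfl⟩ := List.mem_map.1 hl
    have := dualCertificates_valid n (List.mem_range.2 (by omega)) q hq
    exact not_dominatesFrom_of_dualBound_neg hb this.1 this.2

end DistanceChain

section PartialDist

variable {ℓ : ℕ} {G : Matrix (Fin ℓ) (Fin ℓ) (ZMod 2)}

lemma partialDist_le_s14 {i : Fin ℓ} {c : Fin ℓ → ZMod 2}
    (hc : c ∈ Submodule.span (ZMod 2) {v : Fin ℓ → ZMod 2 | ∃ j, i < j ∧ v = G j}) :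
    partialDist G i ≤ hammingDist (G i) c :=
  Nat.sInf_le ⟨c, hc, rfl⟩

lemma partialDist_le_size (i : Fin ℓ) : partialDist G i ≤ ℓ := by
  have h := partialDist_le_s14 (G := G) (i := i) (Submodule.zero_mem _)
  simpa using h.trans hammingDist_le_card_fintype

lemma one_le_partialDist (hG : IsUnit G) (i : Fin ℓ) : 1 ≤ partialDist G i := by
  rw [Nat.one_le_iff_ne_zero]
  intro h0
  obtain ⟨c, hc, hd⟩ := Nat.sInf_mem (s := {d : ℕ | ∃ c ∈ Submodule.span (ZMod 2)
    {v : Fin ℓ → ZMod 2 | ∃ j, i < j ∧ v = G j}, d = hammingDist (G i) c}) ⟨_, 0, zero_mem _, rfl⟩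
  have hd : 0 = hammingDist (G i) c := h0.symm.trans hd
  rw [← hammingDist_eq_zero.1 hd.symm] at hc
  have hli : LinearIndependent (ZMod 2) G.row := Matrix.linearIndependent_rows_iff_isUnit.2 hG
  refine hli.notMem_span_image (s := Set.Ioi i) (x := i) (by simp) ?_
  have hset : G.row '' Set.Ioi i = {v : Fin ℓ → ZMod 2 | ∃ j, i < j ∧ v = G j} := by
    ext v
    exact exists_congr fun j => and_congr_right fun _ => eq_comm
  rw [hset]
  exact hc

lemma partialDist_le_hammingNorm_sum {U : Finset (Fin ℓ)} (hU : U.Nonempty) :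
    partialDist G (U.min' hU) ≤ hammingNorm (∑ i ∈ U, G.row i) := by
  have hspan : ∑ i ∈ U.erase (U.min' hU), G.row i ∈
      Submodule.span (ZMod 2) {v : Fin ℓ → ZMod 2 | ∃ j, U.min' hU < j ∧ v = G j} :=
    Submodule.sum_mem _ fun i hi =>
      Submodule.subset_span ⟨i, U.min'_lt_of_mem_erase_min' hU hi, rfl⟩
  have h : _ ≤ hammingDist (G.row (U.min' hU)) _ := partialDist_le_s14 hspan
  rwa [hammingDist_eq_hammingNorm, neg_eq_of_add_eq_zero_left (word_add_self _),
    Finset.add_sum_erase U _ (U.min'_mem hU)] at h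

lemma isDistanceChain_of_antitone (e : ℕ → Fin ℓ) (he : Set.InjOn e (Set.Iio ℓ))
    (hanti : ∀ j k, j ≤ k → k < ℓ → partialDist G (e k) ≤ partialDist G (e j)) :
    IsDistanceChain (fun k => G.row (e k)) fun k => partialDist G (e k) := by
  intro k hk c hc
  obtain ⟨T, hT, rfl⟩ := exists_sum_eq_of_mem_words hc
  have hkT : k ∉ T := fun h => Finset.notMem_range_self (hT h)
  have hle : ∀ j ∈ insert k T, j ≤ k := by
    intro j hj
    rcases Finset.mem_insert.1 hj with rfl | hj
    · exact le_rfl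
    · exact (Finset.mem_range.1 (hT hj)).le
  have hne : ((insert k T).image e).Nonempty := (Finset.insert_nonempty k T).image e
  have h := partialDist_le_hammingNorm_sum (G := G) hne
  rw [Finset.sum_image fun x hx y hy => he ((hle x hx).trans_lt hk) ((hle y hy).trans_lt hk),
    Finset.sum_insert hkT] at h
  obtain ⟨j, hj, hje⟩ := Finset.mem_image.1 (Finset.min'_mem _ hne)
  rw [← hje] at h
  exact (hanti j k (hle j hj) hk).trans h

lemma sq_prod_partialDist_le (h2 : 2 ≤ ℓ) (h14 : ℓ ≤ 14) (hG : IsUnit G) :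
    (∏ i, partialDist G i) ^ 2 ≤ ℓ ^ ℓ := by
  have : NeZero ℓ := ⟨by omega⟩
  let σ := Tuple.sort (OrderDual.toDual ∘ partialDist G)
  let e : ℕ → Fin ℓ := fun k => σ (Fin.ofNat ℓ k)
  have hanti : ∀ j k, j ≤ k → k < ℓ → partialDist G (e k) ≤ partialDist G (e j) := by
    intro j k hjk hk
    refine Tuple.monotone_sort (OrderDual.toDual ∘ partialDist G)
      (?_ : Fin.ofNat ℓ j ≤ Fin.ofNat ℓ k)
    rw [Fin.le_def, Fin.val_ofNat, Fin.val_ofNat, Nat.mod_eq_of_lt hk,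
      Nat.mod_eq_of_lt (hjk.trans_lt hk)]
    exact hjk
  have he : Set.InjOn e (Set.Iio ℓ) := by
    intro j hj k hk hjk
    have := congrArg Fin.val (σ.injective hjk)
    rwa [Fin.val_ofNat, Fin.val_ofNat, Nat.mod_eq_of_lt hj, Nat.mod_eq_of_lt hk] at this
  have hprod := sq_prod_le_of_not_dominatesFrom h2 h14 (d := fun k => partialDist G (e k))
    (fun k _ => one_le_partialDist hG _) (fun k _ => partialDist_le_size _) hanti
    (fun l hl => (isDistanceChain_of_antitone e he hanti).not_dominatesFrom h14 hl)
  rw [Finset.prod_range] at hprod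
  simpa [e, Equiv.prod_comp σ (partialDist G)] using hprod

end PartialDist

/-- No matrix of size less than 15 has exponent exceeding 1/2: for `2 ≤ ℓ ≤ 14` and
any invertible `ℓ×ℓ` matrix `G` over GF(2), `(∏ D_i)² ≤ ℓ^ℓ`, equivalently
`E(G) ≤ 1/2`. -/
theorem stmt14 (ℓ : ℕ) (h2 : 2 ≤ ℓ) (h14 : ℓ ≤ 14)
    (G : Matrix (Fin ℓ) (Fin ℓ) (ZMod 2)) (hG : IsUnit G) :
    (∏ i, partialDist G i) ^ 2 ≤ ℓ ^ ℓ ∧ expE G ≤ 1/2 := by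
  have hsq := sq_prod_partialDist_le h2 h14 hG
  refine ⟨hsq, ?_⟩
  have hℓ : (1 : ℝ) < ℓ := by exact_mod_cast h2
  have hpos : ∀ i, (0 : ℝ) < partialDist G i := fun i => by exact_mod_cast one_le_partialDist hG i
  have hlog : 2 * ∑ i, Real.logb ℓ (partialDist G i) ≤ ℓ := by
    rw [← Real.logb_prod _ _ fun i _ => (hpos i).ne', ← Nat.cast_ofNat (R := ℝ) (n := 2),
      ← Real.logb_pow, Real.logb_le_iff_le_rpow hℓ (pow_pos (Finset.prod_pos fun i _ => hpos i) 2),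
      Real.rpow_natCast]
    exact_mod_cast hsq
  rw [expE, one_div_mul_eq_div, div_le_div_iff₀ (by linarith) two_pos]
  linarith
end
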